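/- (Privalov factorization) Let p > 1. Every function f ∈ N^p with f not identically zero has a unique factorization f(z) = B(z)S(z)F(z), z ∈ 𝔻, where B is the Blaschke product formed from the zeros of f, S is a singular inner function, and F is an outer function with log⁺|F*| ∈ L^p(𝕋). Conversely, every product B·S·F of a Blaschke product B, a singular inner function S, and an outer function F with log⁺|F*| ∈ L^p(𝕋) belongs to N^p. -/

import Mathlib

open MeasureTheory Filter Set
open scoped ENNReal Topology Real NNReal

noncomputable section

/-- The open unit disk in the complex plane. -/
def unitDisk : Set ℂ := Metric.ball 0 1

/-- The point `r·e^{iθ}`. -/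
def circlePt (r θ : ℝ) : ℂ := (r : ℂ) * Complex.exp (θ * Complex.I)

/-- The maximal radial function `Mf(θ) = sup_{0 ≤ r < 1} |f(r e^{iθ})|`, valued in `ℝ≥0∞`. -/
def maxRad (f : ℂ → ℂ) (θ : ℝ) : ℝ≥0∞ :=
  ⨆ r ∈ Set.Ico (0 : ℝ) 1, (‖f (circlePt r θ)‖₊ : ℝ≥0∞)

/-- `log⁺` on `ℝ≥0∞`. -/
def elogPlus (x : ℝ≥0∞) : ℝ≥0∞ :=
  if x = ∞ then ∞ else ENNReal.ofReal (Real.log x.toReal)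

/-- `x ↦ log (1 + x)` on `ℝ≥0∞`. -/
def elog1p (x : ℝ≥0∞) : ℝ≥0∞ :=
  if x = ∞ then ∞ else ENNReal.ofReal (Real.log (1 + x.toReal))

/-- The radial boundary value `f*(e^{iθ}) = lim_{r→1⁻} f(r e^{iθ})`
(a junk value is returned where the limit does not exist). -/
def radialLimit (f : ℂ → ℂ) (θ : ℝ) : ℂ :=
  limUnder (nhdsWithin (1 : ℝ) (Set.Iio 1)) fun r : ℝ => f (circlePt r θ)

/-- The class `M^p`: holomorphic functions on the unit disk with
`∫₀^{2π} (log⁺ Mf(θ))^p dθ/2π < ∞`. -/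
def MpClass (p : ℝ) : Set (ℂ → ℂ) :=
  {f | DifferentiableOn ℂ f unitDisk ∧
    (∫⁻ θ in Set.Ioc 0 (2 * π), elogPlus (maxRad f θ) ^ p) / ENNReal.ofReal (2 * π) < ∞}

/-- The metric `ρ_p` on `M^p`. -/
def rhoMetric (p : ℝ) (f g : ℂ → ℂ) : ℝ≥0∞ :=
  ((∫⁻ θ in Set.Ioc 0 (2 * π), elog1p (maxRad (f - g) θ) ^ p) /
    ENNReal.ofReal (2 * π)) ^ (1 / p)

/-- The Privalov class `N^p`: holomorphic functions on the unit disk with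
`sup_{0≤r<1} ∫₀^{2π} (log⁺|f(re^{iθ})|)^p dθ/2π < ∞`. -/
def NpClass (p : ℝ) : Set (ℂ → ℂ) :=
  {f | DifferentiableOn ℂ f unitDisk ∧
    (⨆ r ∈ Set.Ico (0 : ℝ) 1,
      (∫⁻ θ in Set.Ioc 0 (2 * π),
        ENNReal.ofReal (Real.log ‖f (circlePt r θ)‖) ^ p) / ENNReal.ofReal (2 * π)) < ∞}

/-- The metric `d_p` on `N^p`, defined via boundary values. -/
def dMetric (p : ℝ) (f g : ℂ → ℂ) : ℝ≥0∞ :=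
  ((∫⁻ θ in Set.Ioc 0 (2 * π),
      ENNReal.ofReal (Real.log (1 + ‖radialLimit f θ - radialLimit g θ‖)) ^ p) /
    ENNReal.ofReal (2 * π)) ^ (1 / p)

/-- The Hardy space `H^p`. -/
def HpClass (p : ℝ) : Set (ℂ → ℂ) :=
  {f | DifferentiableOn ℂ f unitDisk ∧
    (⨆ r ∈ Set.Ico (0 : ℝ) 1,
      (∫⁻ θ in Set.Ioc 0 (2 * π), (‖f (circlePt r θ)‖₊ : ℝ≥0∞) ^ p) /
        ENNReal.ofReal (2 * π)) < ∞}

/-- The Smirnov class `N⁺`. -/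
def SmirnovClass : Set (ℂ → ℂ) :=
  {f | DifferentiableOn ℂ f unitDisk ∧
    (∫⁻ θ in Set.Ioc 0 (2 * π), ENNReal.ofReal (Real.log ‖radialLimit f θ‖)) /
      ENNReal.ofReal (2 * π) < ∞ ∧
    Tendsto
      (fun r : ℝ => (∫⁻ θ in Set.Ioc 0 (2 * π),
        ENNReal.ofReal (Real.log ‖f (circlePt r θ)‖)) / ENNReal.ofReal (2 * π))
      (nhdsWithin (1 : ℝ) (Set.Iio 1))
      (nhds ((∫⁻ θ in Set.Ioc 0 (2 * π),
        ENNReal.ofReal (Real.log ‖radialLimit f θ‖)) / ENNReal.ofReal (2 * π)))}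

/-- The normalized Blaschke factor `(|a|/a)·(a − z)/(1 − conj a · z)`. -/
def blaschkeFactor (a z : ℂ) : ℂ :=
  ((‖a‖ : ℂ) / a) * ((a - z) / (1 - (starRingEnd ℂ) a * z))

/-- `B` is a (finite or infinite) Blaschke product on the unit disk. -/
def IsBlaschkeProduct (B : ℂ → ℂ) : Prop :=
  ∃ m : ℕ,
    (∃ n : ℕ, ∃ a : ℕ → ℂ, (∀ k < n, a k ∈ unitDisk ∧ a k ≠ 0) ∧
      ∀ z ∈ unitDisk, B z = z ^ m * ∏ k ∈ Finset.range n, blaschkeFactor (a k) z) ∨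
    (∃ a : ℕ → ℂ, (∀ k, a k ∈ unitDisk ∧ a k ≠ 0) ∧ (Summable fun k => 1 - ‖a k‖) ∧
      ∀ z ∈ unitDisk, B z = z ^ m * ∏' k, blaschkeFactor (a k) z)

/-- `I` is an ideal of the ring `M^p`. -/
structure IsIdealIn (p : ℝ) (I : Set (ℂ → ℂ)) : Prop where
  subset : I ⊆ MpClass p
  zero_mem : (0 : ℂ → ℂ) ∈ I
  add_mem : ∀ f ∈ I, ∀ g ∈ I, f + g ∈ I
  neg_mem : ∀ f ∈ I, -f ∈ I
  mul_mem : ∀ f ∈ MpClass p, ∀ g ∈ I, f * g ∈ I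

/-- `I` is a prime ideal of the ring `M^p`: an ideal such that whenever a product of two
elements of `M^p` lies in `I`, one of the factors lies in `I`. -/
def IsPrimeIdealIn (p : ℝ) (I : Set (ℂ → ℂ)) : Prop :=
  IsIdealIn p I ∧ ∀ f ∈ MpClass p, ∀ g ∈ MpClass p, f * g ∈ I → f ∈ I ∨ g ∈ I

/-- `I` is a dense subset of the metric space `(M^p, ρ_p)`. -/
def IsDenseIn (p : ℝ) (I : Set (ℂ → ℂ)) : Prop :=
  ∀ f ∈ MpClass p, ∀ ε : ℝ≥0∞, 0 < ε → ∃ g ∈ I, rhoMetric p f g < ε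

/-- `I` is an ideal of the ring `N^p`. -/
structure IsIdealInNp (p : ℝ) (I : Set (ℂ → ℂ)) : Prop where
  subset : I ⊆ NpClass p
  zero_mem : (0 : ℂ → ℂ) ∈ I
  add_mem : ∀ f ∈ I, ∀ g ∈ I, f + g ∈ I
  neg_mem : ∀ f ∈ I, -f ∈ I
  mul_mem : ∀ f ∈ NpClass p, ∀ g ∈ I, f * g ∈ I

/-- `I` is a prime ideal of the ring `N^p`. -/
def IsPrimeIdealInNp (p : ℝ) (I : Set (ℂ → ℂ)) : Prop :=
  IsIdealInNp p I ∧ ∀ f ∈ NpClass p, ∀ g ∈ NpClass p, f * g ∈ I → f ∈ I ∨ g ∈ I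

/-- `I` is a dense subset of the metric space `(N^p, d_p)`. -/
def IsDenseInNp (p : ℝ) (I : Set (ℂ → ℂ)) : Prop :=
  ∀ f ∈ NpClass p, ∀ ε : ℝ≥0∞, 0 < ε → ∃ g ∈ I, dMetric p f g < ε


/-- `S` is a singular inner function: `S(z) = exp(−∫ (e^{it}+z)/(e^{it}−z) dμ(t))` for some
finite positive measure `μ` on the circle which is singular with respect to Lebesgue measure. -/
def IsSingularInner (S : ℂ → ℂ) : Prop :=
  ∃ μ : Measure ℝ, IsFiniteMeasure μ ∧ μ ⟂ₘ (volume : Measure ℝ) ∧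
    μ (Set.Ioc 0 (2 * π))ᶜ = 0 ∧
    ∀ z ∈ unitDisk, S z = Complex.exp
      (-∫ t, (Complex.exp (t * Complex.I) + z) / (Complex.exp (t * Complex.I) - z) ∂μ)

/-- `F` is an outer function:
`F(z) = ω·exp((1/2π) ∫₀^{2π} (e^{it}+z)/(e^{it}−z) · log|F*(e^{it})| dt)` with `|ω| = 1` and
`log|F*| ∈ L¹(𝕋)`. -/
def IsOuter (F : ℂ → ℂ) : Prop :=
  ∃ ω : ℂ, ‖ω‖ = 1 ∧
    IntegrableOn (fun t => Real.log ‖radialLimit F t‖) (Set.Ioc 0 (2 * π)) volume ∧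
    ∀ z ∈ unitDisk, F z = ω * Complex.exp ((1 / (2 * (π : ℂ))) *
      ∫ t in Set.Ioc 0 (2 * π),
        ((Complex.exp (t * Complex.I) + z) / (Complex.exp (t * Complex.I) - z)) *
          ((Real.log ‖radialLimit F t‖ : ℝ) : ℂ))

/-- `log⁺ |F*| ∈ L^p(𝕋)`. -/
def LogPlusBoundaryLp (p : ℝ) (F : ℂ → ℂ) : Prop :=
  (∫⁻ t in Set.Ioc 0 (2 * π), ENNReal.ofReal (Real.log ‖radialLimit F t‖) ^ p) < ∞


/-- Herglotz kernel. -/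
def hK (z : ℂ) (t : ℝ) : ℂ :=
  (Complex.exp (t * Complex.I) + z) / (Complex.exp (t * Complex.I) - z)

/-- Poisson kernel. -/
def pK (z : ℂ) (t : ℝ) : ℝ := (1 - ‖z‖ ^ 2) / ‖Complex.exp (t * Complex.I) - z‖ ^ 2

/-- Normalized Lebesgue measure on `(0, 2π]`. -/
def mC : Measure ℝ := ENNReal.ofReal (1 / (2 * π)) • volume.restrict (Set.Ioc 0 (2 * π))

instance mC_prob : IsProbabilityMeasure mC := by
  constructor
  have : (0:ℝ) < 2 * π := by positivity
  simp only [mC, Measure.smul_apply, MeasurableSet.univ, Measure.restrict_apply, univ_inter,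
    Real.volume_Ioc, sub_zero, smul_eq_mul]
  rw [← ENNReal.ofReal_mul (by positivity)]
  rw [one_div, inv_mul_cancel₀ this.ne', ENNReal.ofReal_one]

lemma mem_unitDisk {z : ℂ} : z ∈ unitDisk ↔ ‖z‖ < 1 := by simp [unitDisk]

lemma isOpen_unitDisk : IsOpen unitDisk := Metric.isOpen_ball

lemma norm_circlePt {r θ : ℝ} (hr : 0 ≤ r) : ‖circlePt r θ‖ = r := by
  simp [circlePt, Complex.norm_exp_ofReal_mul_I, abs_of_nonneg hr]

lemma circlePt_mem {r θ : ℝ} (hr : 0 ≤ r) (hr1 : r < 1) : circlePt r θ ∈ unitDisk := by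
  rw [mem_unitDisk, norm_circlePt hr]; exact hr1

lemma exp_sub_lower (z : ℂ) (t : ℝ) : 1 - ‖z‖ ≤ ‖Complex.exp (t * Complex.I) - z‖ := by
  have := norm_sub_norm_le (Complex.exp (t * Complex.I)) z
  rwa [Complex.norm_exp_ofReal_mul_I] at this

lemma exp_sub_ne {z : ℂ} (hz : z ∈ unitDisk) (t : ℝ) : Complex.exp (t * Complex.I) - z ≠ 0 := by
  rw [← norm_pos_iff]
  have := exp_sub_lower z t
  rw [mem_unitDisk] at hz
  linarith

lemma hK_re (z : ℂ) (t : ℝ) : (hK z t).re = pK z t := by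
  have := congrFun (poissonKernel_eq_re_herglotzRieszKernel (c := 0) (w := z))
    (Complex.exp (t * Complex.I))
  simp only [poissonKernel, herglotzRieszKernel, Function.comp, sub_zero,
    Complex.norm_exp_ofReal_mul_I] at this
  rw [hK, pK, ← this]; simp

lemma norm_hK_le {z : ℂ} (hz : z ∈ unitDisk) (t : ℝ) : ‖hK z t‖ ≤ 2 / (1 - ‖z‖) := by
  have h := exp_sub_lower z t
  rw [mem_unitDisk] at hz
  rw [hK, norm_div]
  have h2 : ‖Complex.exp (t * Complex.I) + z‖ ≤ 2 := by
    refine (norm_add_le _ _).trans ?_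
    rw [Complex.norm_exp_ofReal_mul_I]; linarith
  have : 0 < 1 - ‖z‖ := by linarith
  gcongr

lemma pK_pos {z : ℂ} (hz : z ∈ unitDisk) (t : ℝ) : 0 < pK z t := by
  have h := norm_pos_iff.2 (exp_sub_ne hz t)
  rw [mem_unitDisk] at hz
  rw [pK]
  have : 0 < 1 - ‖z‖ ^ 2 := by nlinarith [norm_nonneg z]
  positivity

lemma pK_le {z : ℂ} (hz : z ∈ unitDisk) (t : ℝ) : pK z t ≤ 2 / (1 - ‖z‖) := by
  rw [← hK_re]
  exact (Complex.re_le_norm _).trans (norm_hK_le hz t)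

lemma continuous_hK {z : ℂ} (hz : z ∈ unitDisk) : Continuous (hK z) := by
  unfold hK
  refine Continuous.div (by fun_prop) (by fun_prop) (fun t => exp_sub_ne hz t)

lemma continuous_pK {z : ℂ} (hz : z ∈ unitDisk) : Continuous (pK z) := by
  have : pK z = fun t => (hK z t).re := by ext t; rw [hK_re]
  rw [this]
  exact Complex.continuous_re.comp (continuous_hK hz)

lemma pK_symm {r : ℝ} (hr : 0 ≤ r) (θ s : ℝ) : pK (circlePt r θ) s = pK (circlePt r s) θ := by
  unfold pK
  rw [norm_circlePt hr, norm_circlePt hr]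
  congr 2
  have h1 : Complex.exp (s * Complex.I) - circlePt r θ = Complex.exp (s * Complex.I) *
    Complex.exp (θ * Complex.I) * (Complex.exp (-(θ:ℝ) * Complex.I) -
      r * Complex.exp (-(s:ℝ) * Complex.I)) := by
    unfold circlePt
    have e1 : Complex.exp (θ * Complex.I) * Complex.exp (-(θ:ℝ) * Complex.I) = 1 := by
      rw [← Complex.exp_add]; simp
    have e2 : Complex.exp (s * Complex.I) * Complex.exp (-(s:ℝ) * Complex.I) = 1 := by
      rw [← Complex.exp_add]; simp
    linear_combination (-Complex.exp (s * Complex.I)) * e1 + r * Complex.exp (θ * Complex.I) * e2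
  have h2 : (Complex.exp (-(θ:ℝ) * Complex.I) - r * Complex.exp (-(s:ℝ) * Complex.I)) =
    (starRingEnd ℂ) (Complex.exp (θ * Complex.I) - circlePt r s) := by
    simp [circlePt, ← Complex.exp_conj]
  rw [h1, h2, norm_mul, norm_mul, Complex.norm_exp_ofReal_mul_I, Complex.norm_exp_ofReal_mul_I,
    RCLike.norm_conj]
  ring

lemma integral_mC {E : Type*} [NormedAddCommGroup E] [NormedSpace ℝ E] (f : ℝ → E) :
    ∫ t, f t ∂mC = (2 * π)⁻¹ • ∫ t in Set.Ioc 0 (2 * π), f t := by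
  rw [mC, integral_smul_measure, ENNReal.toReal_ofReal (by positivity), one_div]

lemma integral_mC_circle {E : Type*} [NormedAddCommGroup E] [NormedSpace ℝ E] (f : ℂ → E) :
    ∫ t, f (Complex.exp (t * Complex.I)) ∂mC = Real.circleAverage f 0 1 := by
  rw [integral_mC, Real.circleAverage_def, intervalIntegral.integral_of_le (by positivity)]
  simp [circleMap]

lemma poisson_formula {f : ℂ → ℂ} (hf : DiffContOnCl ℂ f (Metric.ball 0 1)) {z : ℂ}
    (hz : z ∈ unitDisk) : ∫ t, (pK z t : ℂ) * f (Complex.exp (t * Complex.I)) ∂mC = f z := by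
  have h := hf.circleAverage_poissonKernel_smul (w := z) hz
  rw [← integral_mC_circle] at h
  rw [← h]
  congr 1
  ext t
  simp [pK, poissonKernel, Complex.norm_exp_ofReal_mul_I]

lemma integrable_bdd_mul {α : Measure ℝ} {g u : ℝ → ℂ} (hu : Integrable u α) (hg : Continuous g)
    (C : ℝ) (hC : ∀ t, ‖g t‖ ≤ C) : Integrable (fun t => g t * u t) α :=
  hu.bdd_mul hg.aestronglyMeasurable (Eventually.of_forall hC)

lemma integrable_hK {α : Measure ℝ} {u : ℝ → ℂ} (hu : Integrable u α) {z : ℂ}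
    (hz : z ∈ unitDisk) : Integrable (fun t => hK z t * u t) α :=
  integrable_bdd_mul hu (continuous_hK hz) _ (norm_hK_le hz)

lemma integrable_hK_one (α : Measure ℝ) [IsFiniteMeasure α] {z : ℂ}
    (hz : z ∈ unitDisk) : Integrable (fun t => hK z t) α := by
  simpa using integrable_hK (u := fun _ => 1) (integrable_const (μ := α) (1:ℂ)) hz

lemma integrable_pK {α : Measure ℝ} {u : ℝ → ℝ} (hu : Integrable u α) {z : ℂ}
    (hz : z ∈ unitDisk) : Integrable (fun t => pK z t * u t) α := by
  refine hu.bdd_mul (c := 2 / (1 - ‖z‖)) (continuous_pK hz).aestronglyMeasurable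
    (Eventually.of_forall fun t => ?_)
  rw [Real.norm_of_nonneg (pK_pos hz t).le]
  exact pK_le hz t

lemma integrable_pK_one (α : Measure ℝ) [IsFiniteMeasure α] {z : ℂ}
    (hz : z ∈ unitDisk) : Integrable (fun t => pK z t) α := by
  simpa using integrable_pK (u := fun _ => 1) (integrable_const (μ := α) (1:ℝ)) hz

lemma integral_pK_mC {z : ℂ} (hz : z ∈ unitDisk) : ∫ t, pK z t ∂mC = 1 := by
  have h := poisson_formula (f := fun _ => 1) diffContOnCl_const hz
  simp only [mul_one] at h
  have h2 : ∫ t, ((pK z t : ℝ) : ℂ) ∂mC = ((∫ t, pK z t ∂mC : ℝ) : ℂ) := integral_ofReal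
  rw [h2] at h
  exact_mod_cast h

lemma re_integral_hK {α : Measure ℝ} {u : ℝ → ℝ} (hu : Integrable u α) {z : ℂ}
    (hz : z ∈ unitDisk) : (∫ t, hK z t * (u t : ℂ) ∂α).re = ∫ t, pK z t * u t ∂α := by
  have h : Integrable (fun t => hK z t * (u t : ℂ)) α := integrable_hK hu.ofReal hz
  have h2 : ∫ t, (hK z t * (u t : ℂ)).re ∂α = (∫ t, hK z t * (u t : ℂ) ∂α).re := integral_re h
  rw [← h2]
  congr 1
  ext t
  rw [← hK_re]
  simp

lemma re_integral_hK_one (α : Measure ℝ) [IsFiniteMeasure α] {z : ℂ}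
    (hz : z ∈ unitDisk) : (∫ t, hK z t ∂α).re = ∫ t, pK z t ∂α := by
  simpa using re_integral_hK (u := fun _ => 1) (integrable_const (μ := α) (1:ℝ)) hz

lemma differentiableOn_integral_hK {α : Measure ℝ} {u : ℝ → ℂ} (hu : Integrable u α) :
    DifferentiableOn ℂ (fun z => ∫ t, hK z t * u t ∂α) unitDisk := by
  intro z hz
  apply DifferentiableAt.differentiableWithinAt
  have hz1 := mem_unitDisk.1 hz
  set d := (1 - ‖z‖) / 2 with hd
  have hd0 : 0 < d := by rw [hd]; linarith
  have hball : ∀ x ∈ Metric.ball z d, ‖x‖ < 1 - d := by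
    intro x hx
    have : ‖x - z‖ < d := by simpa [dist_eq_norm] using hx
    have h2 : ‖x‖ ≤ ‖x - z‖ + ‖z‖ := by simpa using norm_add_le (x - z) z
    rw [hd] at *; linarith
  have hbd : ∀ x ∈ Metric.ball z d, x ∈ unitDisk := by
    intro x hx; rw [mem_unitDisk]; have := hball x hx; linarith
  refine (hasDerivAt_integral_of_dominated_loc_of_deriv_le (μ := α)
    (F := fun x t => hK x t * u t)
    (F' := fun x t => (2 * Complex.exp (t * Complex.I) / (Complex.exp (t * Complex.I) - x) ^ 2)
      * u t)
    (bound := fun t => 2 / d ^ 2 * ‖u t‖) (x₀ := z)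
    (Metric.ball_mem_nhds z hd0) ?_ (integrable_hK hu hz) ?_ ?_ ?_ ?_).2.differentiableAt
  · filter_upwards [Metric.ball_mem_nhds z hd0] with x hx
    exact (integrable_hK hu (hbd x hx)).aestronglyMeasurable
  · refine AEStronglyMeasurable.mul ?_ hu.aestronglyMeasurable
    apply Continuous.aestronglyMeasurable
    refine Continuous.div (by fun_prop) (by fun_prop) (fun t => pow_ne_zero _ (exp_sub_ne hz t))
  · refine Eventually.of_forall fun t x hx => ?_
    rw [norm_mul, norm_div, norm_mul, norm_pow, Complex.norm_exp_ofReal_mul_I]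
    have h1 := exp_sub_lower x t
    have h2 := hball x hx
    have h3 : d ≤ ‖Complex.exp (t * Complex.I) - x‖ := by linarith
    simp only [Complex.norm_ofNat, mul_one]
    gcongr
  · exact hu.norm.const_mul _
  · refine Eventually.of_forall fun t x hx => ?_
    have hne := exp_sub_ne (hbd x hx) t
    have h3 := ((hasDerivAt_id' x).const_add (Complex.exp (t * Complex.I))).div
        ((hasDerivAt_id' x).const_sub (Complex.exp (t * Complex.I))) hne
    have h4 := h3.mul_const (u t)
    refine h4.congr_deriv ?_
    congr 1
    congr 1
    ring

lemma const_of_re_eq_zero {D : ℂ → ℂ} (hD : DifferentiableOn ℂ D unitDisk)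
    (h : ∀ z ∈ unitDisk, (D z).re = 0) : ∀ z ∈ unitDisk, D z = D 0 := by
  have ha : AnalyticOnNhd ℂ D unitDisk := hD.analyticOnNhd isOpen_unitDisk
  have hc : IsPreconnected unitDisk := (convex_ball (0:ℂ) 1).isPreconnected
  have h0 : (0:ℂ) ∈ unitDisk := by simp [mem_unitDisk]
  rcases ha.is_constant_or_isOpen hc with ⟨w, hw⟩ | ho
  · intro z hz; rw [hw z hz, hw 0 h0]
  · exfalso
    have hopen := ho unitDisk subset_rfl isOpen_unitDisk
    obtain ⟨ε, hε, hs⟩ := Metric.isOpen_iff.1 hopen (D 0) ⟨0, h0, rfl⟩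
    have : D 0 + (ε / 2 : ℝ) ∈ D '' unitDisk := by
      apply hs
      simp only [Metric.mem_ball, dist_self_add_left, Complex.norm_real]
      rw [Real.norm_of_nonneg (by positivity)]; linarith
    obtain ⟨w, hw, hw2⟩ := this
    have h1 := h w hw
    rw [hw2] at h1
    simp [h 0 h0] at h1
    linarith

lemma hK_zero (t : ℝ) : hK 0 t = 1 := by simp [hK]

/-- Schwarz integral formula. -/
lemma schwarz_formula {k : ℂ → ℂ} (hk : DiffContOnCl ℂ k (Metric.ball 0 1)) {z : ℂ}
    (hz : z ∈ unitDisk) :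
    k z = (k 0).im * Complex.I +
      ∫ t, hK z t * ((k (Complex.exp (t * Complex.I))).re : ℂ) ∂mC := by
  have hcont : Continuous fun t : ℝ => k (Complex.exp (t * Complex.I)) := by
    have h1 : ContinuousOn k (Metric.closedBall 0 1) := by
      have := hk.continuousOn
      rwa [closure_ball _ one_ne_zero] at this
    refine h1.comp_continuous (by fun_prop) (fun t => ?_)
    simp [Complex.norm_exp_ofReal_mul_I]
  have hintg : ∀ g : ℝ → ℂ, (∃ C, ∀ t, ‖g t‖ ≤ C) → Continuous g → Integrable g mC := by
    rintro g ⟨C, hC⟩ hg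
    exact Integrable.of_bound hg.aestronglyMeasurable C (Eventually.of_forall hC)
  have hbdd : ∃ C, ∀ t : ℝ, ‖k (Complex.exp (t * Complex.I))‖ ≤ C := by
    have h1 : ContinuousOn k (Metric.closedBall 0 1) := by
      have := hk.continuousOn
      rwa [closure_ball _ one_ne_zero] at this
    obtain ⟨C, hC⟩ := (isCompact_closedBall (0:ℂ) 1).exists_bound_of_continuousOn h1
    exact ⟨C, fun t => hC _ (by simp [Complex.norm_exp_ofReal_mul_I])⟩
  have hi := hintg _ hbdd hcont
  have hir : Integrable (fun t : ℝ => (k (Complex.exp (t * Complex.I))).re) mC := hi.re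
  have hD : DifferentiableOn ℂ (fun z => (∫ t, hK z t * ((k (Complex.exp (t * Complex.I))).re : ℂ)
      ∂mC) - k z) unitDisk :=
    (differentiableOn_integral_hK hir.ofReal).sub hk.differentiableOn
  have hre : ∀ z ∈ unitDisk, ((∫ t, hK z t * ((k (Complex.exp (t * Complex.I))).re : ℂ)
      ∂mC) - k z).re = 0 := by
    intro z hz
    rw [Complex.sub_re, re_integral_hK hir hz]
    have h1 := poisson_formula hk hz
    rw [← h1]
    have h2 : Integrable (fun t => (pK z t : ℂ) * k (Complex.exp (t * Complex.I))) mC := by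
      refine integrable_bdd_mul hi (Complex.continuous_ofReal.comp (continuous_pK hz))
        (2 / (1 - ‖z‖)) (fun t => ?_)
      simp only [Function.comp, Complex.norm_real]
      rw [Real.norm_of_nonneg (pK_pos hz t).le]
      exact pK_le hz t
    have h3 := integral_re h2
    simp only [RCLike.re_eq_complex_re] at h3
    rw [← h3]
    simp
  have hc := const_of_re_eq_zero hD hre z hz
  have h0 : (0:ℂ) ∈ unitDisk := by simp [mem_unitDisk]
  have hr0 := hre 0 h0
  have h4 : ∫ t : ℝ, ((k (Complex.exp (t * Complex.I))).re : ℂ) ∂mC =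
    ((∫ t : ℝ, (k (Complex.exp (t * Complex.I))).re ∂mC : ℝ) : ℂ) := integral_ofReal
  simp only [hK_zero, one_mul, h4] at hc hr0
  apply Complex.ext
  · have := hre z hz
    rw [Complex.sub_re] at this
    simp only [Complex.add_re, Complex.mul_re, Complex.ofReal_re, Complex.I_re, mul_zero,
      Complex.ofReal_im, Complex.I_im, mul_one, sub_self, zero_add]
    linarith
  · have := congrArg Complex.im hc
    simp at this ⊢
    linarith


lemma continuous_pK_prod {r : ℝ} (hr : 0 ≤ r) (hr1 : r < 1) :
    Continuous fun q : ℝ × ℝ => pK (circlePt r q.1) q.2 := by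
  unfold pK
  refine Continuous.div ?_ ?_ ?_
  · unfold circlePt; fun_prop
  · unfold circlePt; fun_prop
  · intro q
    exact pow_ne_zero _ (norm_ne_zero_iff.2 (exp_sub_ne (circlePt_mem hr hr1) q.2))

lemma lintegral_pK_mC {z : ℂ} (hz : z ∈ unitDisk) : ∫⁻ t, ENNReal.ofReal (pK z t) ∂mC = 1 := by
  rw [← ofReal_integral_eq_lintegral_ofReal (integrable_pK_one mC hz)
    (Eventually.of_forall fun t => (pK_pos hz t).le), integral_pK_mC hz, ENNReal.ofReal_one]

/-- Jensen inequality for the Poisson kernel. -/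
lemma jensen_pK {p : ℝ} (hp : 1 < p) {z : ℂ} (hz : z ∈ unitDisk) {v : ℝ → ℝ≥0∞}
    (hv : AEMeasurable v mC) :
    (∫⁻ s, ENNReal.ofReal (pK z s) * v s ∂mC) ^ p ≤
      ∫⁻ s, ENNReal.ofReal (pK z s) * v s ^ p ∂mC := by
  have hm : Measurable fun s => ENNReal.ofReal (pK z s) :=
    (continuous_pK hz).measurable.ennreal_ofReal
  set κ := mC.withDensity fun s => ENNReal.ofReal (pK z s) with hκ
  have hac : κ ≪ mC := withDensity_absolutelyContinuous _ _
  have hv' : AEMeasurable v κ := hv.mono_ac hac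
  have e1 : ∫⁻ s, ENNReal.ofReal (pK z s) * v s ∂mC = ∫⁻ s, v s ∂κ := by
    rw [hκ, lintegral_withDensity_eq_lintegral_mul₀ hm.aemeasurable hv]; rfl
  have e2 : ∫⁻ s, ENNReal.ofReal (pK z s) * v s ^ p ∂mC = ∫⁻ s, v s ^ p ∂κ := by
    rw [hκ, lintegral_withDensity_eq_lintegral_mul₀ hm.aemeasurable (hv.pow_const p)]; rfl
  have e3 : κ univ = 1 := by
    rw [hκ, withDensity_apply _ MeasurableSet.univ, Measure.restrict_univ, lintegral_pK_mC hz]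
  have h := ENNReal.lintegral_mul_le_Lp_mul_Lq κ (Real.HolderConjugate.conjExponent hp) hv'
    (g := fun _ => 1) aemeasurable_const
  simp only [Pi.mul_apply, mul_one, ENNReal.one_rpow, lintegral_one, e3] at h
  rw [e1, e2]
  have hp0 : 0 < p := by linarith
  calc (∫⁻ s, v s ∂κ) ^ p ≤ ((∫⁻ s, v s ^ p ∂κ) ^ (1 / p)) ^ p := by gcongr
    _ = ∫⁻ s, v s ^ p ∂κ := by
      rw [← ENNReal.rpow_mul, one_div, inv_mul_cancel₀ hp0.ne', ENNReal.rpow_one]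

/-- The Poisson extension is a contraction in `L^p`. -/
lemma poisson_Lp {p : ℝ} (hp : 1 < p) {r : ℝ} (hr : 0 ≤ r) (hr1 : r < 1) {v : ℝ → ℝ≥0∞}
    (hv : AEMeasurable v mC) :
    ∫⁻ θ, (∫⁻ s, ENNReal.ofReal (pK (circlePt r θ) s) * v s ∂mC) ^ p ∂mC ≤
      ∫⁻ s, v s ^ p ∂mC := by
  calc ∫⁻ θ, (∫⁻ s, ENNReal.ofReal (pK (circlePt r θ) s) * v s ∂mC) ^ p ∂mC
      ≤ ∫⁻ θ, ∫⁻ s, ENNReal.ofReal (pK (circlePt r θ) s) * v s ^ p ∂mC ∂mC :=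
        lintegral_mono fun θ => jensen_pK hp (circlePt_mem hr hr1) hv
    _ = ∫⁻ s, ∫⁻ θ, ENNReal.ofReal (pK (circlePt r θ) s) * v s ^ p ∂mC ∂mC := by
        apply lintegral_lintegral_swap
        refine AEMeasurable.mul ?_ ?_
        · exact (continuous_pK_prod hr hr1).measurable.ennreal_ofReal.aemeasurable
        · exact ((hv.pow_const p).comp_quasiMeasurePreserving
            Measure.quasiMeasurePreserving_snd)
    _ = ∫⁻ s, v s ^ p ∂mC := by
        congr 1
        ext s
        have : Measurable fun θ => ENNReal.ofReal (pK (circlePt r θ) s) :=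
          ((continuous_pK_prod hr hr1).comp
            (by fun_prop : Continuous fun θ : ℝ => (θ, s))).measurable.ennreal_ofReal
        rw [lintegral_mul_const _ this]
        simp_rw [pK_symm hr _ s]
        rw [lintegral_pK_mC (circlePt_mem hr hr1), one_mul]

lemma ofReal_poisson_le {u : ℝ → ℝ} (hu : Integrable u mC) {z : ℂ} (hz : z ∈ unitDisk) :
    ENNReal.ofReal (∫ t, pK z t * u t ∂mC) ≤
      ∫⁻ t, ENNReal.ofReal (pK z t) * ENNReal.ofReal (u t) ∂mC := by
  have hpos : Integrable (fun t => max (u t) 0) mC := hu.pos_part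
  calc ENNReal.ofReal (∫ t, pK z t * u t ∂mC)
      ≤ ENNReal.ofReal (∫ t, pK z t * max (u t) 0 ∂mC) := by
        apply ENNReal.ofReal_le_ofReal
        apply integral_mono (integrable_pK hu hz) (integrable_pK hpos hz)
        intro t
        exact mul_le_mul_of_nonneg_left (le_max_left _ _) (pK_pos hz t).le
    _ = ∫⁻ t, ENNReal.ofReal (pK z t * max (u t) 0) ∂mC := by
        rw [ofReal_integral_eq_lintegral_ofReal (integrable_pK hpos hz)]
        exact Eventually.of_forall fun t => mul_nonneg (pK_pos hz t).le (le_max_right _ _)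
    _ = _ := by
        congr 1
        ext t
        rw [ENNReal.ofReal_mul (pK_pos hz t).le]
        congr 1
        rcases le_total (u t) 0 with h | h
        · rw [max_eq_right h, ENNReal.ofReal_of_nonpos h, ENNReal.ofReal_zero]
        · rw [max_eq_left h]

lemma integrable_mC_iff {E : Type*} [NormedAddCommGroup E] {u : ℝ → E} :
    Integrable u mC ↔ IntegrableOn u (Set.Ioc 0 (2 * π)) volume := by
  rw [mC, integrable_smul_measure]
  · rfl
  · simp only [ne_eq, ENNReal.ofReal_eq_zero, not_le]; positivity
  · exact ENNReal.ofReal_ne_top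

lemma lintegral_mC (v : ℝ → ℝ≥0∞) :
    ∫⁻ t, v t ∂mC = (∫⁻ t in Set.Ioc 0 (2 * π), v t) / ENNReal.ofReal (2 * π) := by
  rw [mC, lintegral_smul_measure, smul_eq_mul, mul_comm, one_div,
    ENNReal.ofReal_inv_of_pos (by positivity)]; rfl

lemma lintegral_mC_lt_top {v : ℝ → ℝ≥0∞} :
    ∫⁻ t, v t ∂mC < ∞ ↔ (∫⁻ t in Set.Ioc 0 (2 * π), v t) < ∞ := by
  rw [lintegral_mC]
  have h1 : ENNReal.ofReal (2 * π) ≠ 0 := by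
    simp only [ne_eq, ENNReal.ofReal_eq_zero, not_le]; positivity
  constructor
  · intro h
    by_contra hc
    rw [not_lt, top_le_iff] at hc
    rw [hc, ENNReal.top_div_of_ne_top ENNReal.ofReal_ne_top] at h
    exact lt_irrefl _ h
  · intro h
    exact ENNReal.div_lt_top h.ne h1

/-- The exponential of the Herglotz integral of `u`. -/
def outerFn (u : ℝ → ℝ) (z : ℂ) : ℂ := Complex.exp (∫ t, hK z t * (u t : ℂ) ∂mC)

lemma norm_outerFn {u : ℝ → ℝ} (hu : Integrable u mC) {z : ℂ} (hz : z ∈ unitDisk) :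
    ‖outerFn u z‖ = Real.exp (∫ t, pK z t * u t ∂mC) := by
  rw [outerFn, Complex.norm_exp, re_integral_hK hu hz]

lemma differentiableOn_outerFn {u : ℝ → ℝ} (hu : Integrable u mC) :
    DifferentiableOn ℂ (outerFn u) unitDisk :=
  (differentiableOn_integral_hK hu.ofReal).cexp

lemma isOuter_iff {F : ℂ → ℂ} : IsOuter F ↔ ∃ ω : ℂ, ‖ω‖ = 1 ∧
    Integrable (fun t => Real.log ‖radialLimit F t‖) mC ∧
    ∀ z ∈ unitDisk, F z = ω * outerFn (fun t => Real.log ‖radialLimit F t‖) z := by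
  unfold IsOuter outerFn
  simp only [integrable_mC_iff, integral_mC, hK]
  have : ∀ x : ℂ, (1 / (2 * (π:ℂ))) * x = (2 * π : ℝ)⁻¹ • x := by
    intro x; rw [Complex.real_smul]; push_cast; rw [one_div]
  simp only [this]

/-- The singular inner function with measure `μ`. -/
def singFn (μ : Measure ℝ) (z : ℂ) : ℂ := Complex.exp (-∫ t, hK z t ∂μ)

lemma norm_singFn (μ : Measure ℝ) [IsFiniteMeasure μ] {z : ℂ} (hz : z ∈ unitDisk) :
    ‖singFn μ z‖ = Real.exp (-∫ t, pK z t ∂μ) := by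
  rw [singFn, Complex.norm_exp, Complex.neg_re, re_integral_hK_one μ hz]

lemma norm_singFn_le (μ : Measure ℝ) [IsFiniteMeasure μ] {z : ℂ} (hz : z ∈ unitDisk) :
    ‖singFn μ z‖ ≤ 1 := by
  rw [norm_singFn μ hz, Real.exp_le_one_iff, neg_nonpos]
  exact integral_nonneg fun t => (pK_pos hz t).le

lemma differentiableOn_singFn (μ : Measure ℝ) [IsFiniteMeasure μ] :
    DifferentiableOn ℂ (singFn μ) unitDisk := by
  have := differentiableOn_integral_hK (u := fun _ => 1) (integrable_const (μ := μ) (1:ℂ))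
  simp only [mul_one] at this
  exact this.neg.cexp

/-- Converse half, given that `b` is holomorphic and bounded by one. -/
lemma converse_aux {p : ℝ} (hp : 1 < p) {b S F : ℂ → ℂ} (hb : DifferentiableOn ℂ b unitDisk)
    (hb1 : ∀ z ∈ unitDisk, ‖b z‖ ≤ 1) (hS : IsSingularInner S) (hF : IsOuter F)
    (hFp : LogPlusBoundaryLp p F) : (fun z => b z * S z * F z) ∈ NpClass p := by
  obtain ⟨μ, hμ, -, -, hSμ⟩ := hS
  obtain ⟨ω, hω, hu, hFu⟩ := isOuter_iff.1 hF
  set u := fun t => Real.log ‖radialLimit F t‖ with hudef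
  have hSμ' : ∀ z ∈ unitDisk, S z = singFn μ z := hSμ
  refine ⟨?_, ?_⟩
  · refine (hb.mul ((differentiableOn_singFn μ).congr hSμ')).mul ?_
    exact ((differentiableOn_outerFn hu).const_mul ω).congr hFu
  · simp only [← lintegral_mC]
    refine lt_of_le_of_lt (iSup₂_le ?_) (lintegral_mC_lt_top.2 hFp)
    intro r hr
    have hp0 : 0 ≤ p := by linarith
    refine le_trans ?_ (poisson_Lp hp hr.1 hr.2 (v := fun t => ENNReal.ofReal (u t))
      hu.aemeasurable.ennreal_ofReal)
    refine lintegral_mono fun θ => ENNReal.rpow_le_rpow ?_ hp0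
    have hz := circlePt_mem (θ := θ) hr.1 hr.2
    refine le_trans ?_ (ofReal_poisson_le hu hz)
    set z := circlePt r θ
    by_cases h0 : b z * S z * F z = 0
    · rw [h0]; simp
    · apply ENNReal.ofReal_le_ofReal
      have h1 : ‖b z * S z * F z‖ ≤ Real.exp (∫ t, pK z t * u t ∂mC) := by
        rw [norm_mul, norm_mul, hSμ' z hz, hFu z hz, norm_mul, hω, one_mul, norm_outerFn hu hz]
        calc _ ≤ 1 * 1 * Real.exp (∫ t, pK z t * u t ∂mC) := by
              gcongr
              · exact hb1 z hz
              · exact norm_singFn_le μ hz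
          _ = _ := by ring
      rw [Real.log_le_iff_le_exp (norm_pos_iff.2 h0)]
      exact h1


/-- Weak compactness of measures supported in `[0, 2π]`. -/
lemma weak_compact (ν : ℕ → Measure ℝ) (C : ℝ≥0) (h1 : ∀ n, 1 ≤ ν n univ)
    (hC : ∀ n, ν n univ ≤ C) (hs : ∀ n, ν n (Set.Icc 0 (2 * π))ᶜ = 0) :
    ∃ μ : Measure ℝ, IsFiniteMeasure μ ∧ μ (Set.Icc 0 (2 * π))ᶜ = 0 ∧
      ∃ φ : ℕ → ℕ, StrictMono φ ∧
        (∀ g : BoundedContinuousFunction ℝ ℂ,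
          Tendsto (fun n => ∫ t, g t ∂(ν (φ n))) atTop (𝓝 (∫ t, g t ∂μ))) ∧
        (∀ G : Set ℝ, IsOpen G → ∀ b : ℝ≥0∞, (∀ n, ν n G ≤ b) → μ G ≤ C * b) := by
  have hne0 : ∀ n, ν n univ ≠ 0 := fun n => (lt_of_lt_of_le one_pos (h1 n)).ne'
  have hnet : ∀ n, ν n univ ≠ ∞ := fun n => ne_top_of_le_ne_top ENNReal.coe_ne_top (hC n)
  have hprob : ∀ n, IsProbabilityMeasure ((ν n univ)⁻¹ • ν n) := by
    intro n
    constructor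
    rw [Measure.smul_apply, smul_eq_mul, ENNReal.inv_mul_cancel (hne0 n) (hnet n)]
  let P : ℕ → ProbabilityMeasure ℝ := fun n => ⟨(ν n univ)⁻¹ • ν n, hprob n⟩
  have hP : ∀ n, (P n : Measure ℝ) = (ν n univ)⁻¹ • ν n := fun n => rfl
  have htight : IsTightMeasureSet {((μ : ProbabilityMeasure ℝ) : Measure ℝ) | μ ∈ Set.range P} := by
    rw [isTightMeasureSet_iff_exists_isCompact_measure_compl_le]
    intro ε hε
    refine ⟨Set.Icc 0 (2 * π), isCompact_Icc, ?_⟩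
    rintro _ ⟨_, ⟨n, rfl⟩, rfl⟩
    rw [hP, Measure.smul_apply, hs n]
    simp
  have hcomp := isCompact_closure_of_isTightMeasureSet htight
  obtain ⟨Q, -, φ₁, hφ₁, hQ⟩ := hcomp.tendsto_subseq (x := P)
    (fun n => subset_closure ⟨n, rfl⟩)
  obtain ⟨m, φ₂, hφ₂, hm⟩ := CompactSpace.tendsto_subseq (fun n => ν (φ₁ n) univ)
  have hmC : m ≤ C := le_of_tendsto' hm fun n => hC _
  have hmt : m ≠ ∞ := ne_top_of_le_ne_top ENNReal.coe_ne_top hmC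
  have hQ2 : Tendsto (P ∘ φ₁ ∘ φ₂) atTop (𝓝 Q) := hQ.comp hφ₂.tendsto_atTop
  have hopen : ∀ G : Set ℝ, IsOpen G → ∀ b : ℝ≥0∞, (∀ n, ν n G ≤ b) →
      (Q : Measure ℝ) G ≤ b := by
    intro G hG b hb
    refine (ProbabilityMeasure.le_liminf_measure_open_of_tendsto hQ2 hG).trans ?_
    refine (liminf_le_limsup).trans ?_
    refine limsup_le_of_le (by isBoundedDefault) (Eventually.of_forall fun n => ?_)
    simp only [Function.comp, hP, Measure.smul_apply, smul_eq_mul]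
    calc (ν (φ₁ (φ₂ n)) univ)⁻¹ * ν (φ₁ (φ₂ n)) G ≤ 1 * b := by
          gcongr
          · exact ENNReal.inv_le_one.2 (h1 _)
          · exact hb _
      _ = b := one_mul _
  have hfin : IsFiniteMeasure (m • (Q : Measure ℝ)) := by
    constructor
    rw [Measure.smul_apply, smul_eq_mul]
    exact ENNReal.mul_lt_top hmt.lt_top (measure_lt_top _ _)
  refine ⟨m • (Q : Measure ℝ), hfin, ?_, φ₁ ∘ φ₂, hφ₁.comp hφ₂, ?_, ?_⟩
  · have := hopen _ isClosed_Icc.isOpen_compl 0 (fun n => (hs n).le)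
    rw [Measure.smul_apply, nonpos_iff_eq_zero.1 this]; simp
  · intro g
    have h2 := (ProbabilityMeasure.tendsto_iff_forall_integral_rclike_tendsto ℂ).1 hQ2 g
    have h3 := ((ENNReal.tendsto_toReal hmt).comp hm).smul h2
    rw [integral_smul_measure]
    refine h3.congr fun n => ?_
    simp only [Function.comp, hP]
    rw [integral_smul_measure, smul_smul, ENNReal.toReal_inv, mul_inv_cancel₀, one_smul]
    exact ENNReal.toReal_ne_zero.2 ⟨hne0 _, hnet _⟩
  · intro G hG b hb
    rw [Measure.smul_apply, smul_eq_mul]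
    exact mul_le_mul' hmC (hopen G hG b hb)


lemma kernel_lemma {w : ℝ → ℝ} (hw0 : ∀ s, 0 ≤ w s) (hw : Integrable w volume) {t M D R : ℝ}
    (hD : 0 ≤ D)
    (hA : ∀ ρ > 0, ∫ s in Metric.closedBall t ρ, w s ≤ M * ρ)
    (hlim : Tendsto (fun ρ => (∫ s in Metric.closedBall t ρ, w s) / ρ) (𝓝[>] 0) (𝓝 0))
    {κ : ℝ → ℝ → ℝ} (hκ0 : ∀ h > 0, ∀ s, 0 ≤ κ h s)
    (hR : ∀ s, w s ≠ 0 → |s - t| ≤ R)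
    (hκ : ∀ h > 0, ∀ s, w s ≠ 0 → κ h s ≤ D / h ∧ κ h s * (s - t) ^ 2 ≤ D * h) :
    Tendsto (fun h => ∫ s, κ h s * w s) (𝓝[>] 0) (𝓝 0) := by
  set A : ℝ → ℝ := fun ρ => ∫ s in Metric.closedBall t ρ, w s with hAdef
  have hA0 : ∀ ρ, 0 ≤ A ρ := fun ρ => integral_nonneg hw0
  -- Tannery
  have hT : Tendsto (fun h => ∑' k : ℕ, 4 * D * (1 / 2) ^ k * (A (2 ^ k * h) / (2 ^ k * h)))
      (𝓝[>] 0) (𝓝 (∑' _ : ℕ, (0:ℝ))) := by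
    refine tendsto_tsum_of_dominated_convergence
      (bound := fun k : ℕ => 4 * D * (1 / 2) ^ k * M) ?_ ?_ ?_
    · exact ((summable_geometric_of_lt_one (by norm_num) (by norm_num)).mul_left _).mul_right _
    · intro k
      have h2 : Tendsto (fun h : ℝ => (2:ℝ) ^ k * h) (𝓝[>] 0) (𝓝[>] 0) := by
        rw [tendsto_nhdsWithin_iff]
        constructor
        · have : Tendsto (fun h : ℝ => (2:ℝ) ^ k * h) (𝓝 0) (𝓝 (2 ^ k * 0)) :=
            (continuous_const_mul _).tendsto _
          rw [mul_zero] at this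
          exact this.mono_left nhdsWithin_le_nhds
        · filter_upwards [self_mem_nhdsWithin] with h hh
          have : (0:ℝ) < h := hh
          have : 0 < (2:ℝ) ^ k * h := by positivity
          exact this
      simpa using (hlim.comp h2).const_mul (4 * D * (1 / 2) ^ k)
    · filter_upwards [self_mem_nhdsWithin] with h hh k
      have hh' : (0:ℝ) < h := hh
      have h3 : 0 < (2:ℝ) ^ k * h := by positivity
      have h4 : 0 ≤ A (2 ^ k * h) / (2 ^ k * h) := div_nonneg (hA0 _) h3.le
      rw [Real.norm_of_nonneg (by positivity)]
      gcongr
      rw [div_le_iff₀ h3]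
      exact hA _ h3
  rw [tsum_zero] at hT
  have hsum : ∀ h > 0, Summable fun k : ℕ =>
      4 * D * (1 / 2) ^ k * (A (2 ^ k * h) / (2 ^ k * h)) := by
    intro h hh
    refine Summable.of_nonneg_of_le (f := fun k : ℕ => 4 * D * (1 / 2) ^ k * M) ?_ ?_ ?_
    · intro k
      have h3 : 0 < (2:ℝ) ^ k * h := by positivity
      have h4 : 0 ≤ A (2 ^ k * h) / (2 ^ k * h) := div_nonneg (hA0 _) h3.le
      positivity
    · intro k
      have h3 : 0 < (2:ℝ) ^ k * h := by positivity
      gcongr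
      rw [div_le_iff₀ h3]
      exact hA _ h3
    · exact ((summable_geometric_of_lt_one (by norm_num) (by norm_num)).mul_left _).mul_right _
  refine tendsto_of_tendsto_of_tendsto_of_le_of_le' tendsto_const_nhds hT ?_ ?_
  · filter_upwards [self_mem_nhdsWithin] with h hh
    exact integral_nonneg fun s => mul_nonneg (hκ0 h hh s) (hw0 s)
  · filter_upwards [self_mem_nhdsWithin] with h hh
    have hh' : (0:ℝ) < h := hh
    obtain ⟨N, hN⟩ : ∃ N : ℕ, R / h < 2 ^ N := pow_unbounded_of_one_lt _ one_lt_two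
    rw [div_lt_iff₀ hh'] at hN
    have hpt : ∀ s, κ h s * w s ≤ ∑ k ∈ Finset.range (N + 1),
        4 * D * (1 / 4) ^ k / h * (Metric.closedBall t (2 ^ k * h)).indicator w s := by
      intro s
      have hnn : ∀ k ∈ Finset.range (N + 1),
          0 ≤ 4 * D * (1 / 4) ^ k / h * (Metric.closedBall t (2 ^ k * h)).indicator w s := by
        intro k _
        have : 0 ≤ (Metric.closedBall t (2 ^ k * h)).indicator w s :=
          indicator_nonneg (fun s _ => hw0 s) s
        positivity
      by_cases hws : w s = 0
      · rw [hws, mul_zero]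
        exact Finset.sum_nonneg hnn
      · have hex : ∃ k : ℕ, |s - t| ≤ 2 ^ k * h := ⟨N, (hR s hws).trans hN.le⟩
        classical
        set k := Nat.find hex with hk
        have hk1 : |s - t| ≤ 2 ^ k * h := Nat.find_spec hex
        have hkN : k ≤ N := Nat.find_min' hex ((hR s hws).trans hN.le)
        have hkey : κ h s ≤ 4 * D * (1 / 4) ^ k / h := by
          obtain ⟨hκ1, hκ2⟩ := hκ h hh s hws
          rcases Nat.eq_zero_or_pos k with hk0 | hk0
          · rw [hk0, pow_zero, mul_one]
            refine hκ1.trans ?_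
            gcongr
            linarith
          · have hlt : ¬ |s - t| ≤ 2 ^ (k - 1) * h := Nat.find_min hex (Nat.sub_lt hk0 one_pos)
            rw [not_le] at hlt
            obtain ⟨j, hj⟩ : ∃ j, k = j + 1 := ⟨k - 1, by omega⟩
            rw [hj, Nat.add_sub_cancel] at hlt
            have h5 : (2 ^ j * h) ^ 2 ≤ (s - t) ^ 2 := by
              rw [← sq_abs (s - t)]
              gcongr
            have h6 : κ h s * (2 ^ j * h) ^ 2 ≤ D * h :=
              (mul_le_mul_of_nonneg_left h5 (hκ0 h hh s)).trans hκ2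
            rw [hj]
            have h7 : 4 * D * (1 / 4 : ℝ) ^ (j + 1) / h = D * h / (2 ^ j * h) ^ 2 := by
              have : ((2:ℝ) ^ j) ^ 2 = 4 ^ j := by rw [← pow_mul, mul_comm, pow_mul]; norm_num
              rw [mul_pow, this, pow_succ, one_div_pow]
              field_simp
            rw [h7, le_div_iff₀ (by positivity)]
            exact h6
        calc κ h s * w s ≤ 4 * D * (1 / 4) ^ k / h * w s :=
              mul_le_mul_of_nonneg_right hkey (hw0 s)
          _ = 4 * D * (1 / 4) ^ k / h * (Metric.closedBall t (2 ^ k * h)).indicator w s := by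
              rw [indicator_of_mem]
              rwa [Metric.mem_closedBall, Real.dist_eq]
          _ ≤ _ := Finset.single_le_sum (f := fun k => 4 * D * (1 / 4) ^ k / h *
              (Metric.closedBall t (2 ^ k * h)).indicator w s) hnn
              (Finset.mem_range.2 (by omega))
    have hintg : ∀ k : ℕ, Integrable (fun s => 4 * D * (1 / 4) ^ k / h *
        (Metric.closedBall t (2 ^ k * h)).indicator w s) volume := fun k =>
      (hw.indicator Metric.isClosed_closedBall.measurableSet).const_mul _
    calc ∫ s, κ h s * w s ≤ ∫ s, ∑ k ∈ Finset.range (N + 1),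
        4 * D * (1 / 4) ^ k / h * (Metric.closedBall t (2 ^ k * h)).indicator w s := by
          refine integral_mono_of_nonneg (Eventually.of_forall fun s =>
            mul_nonneg (hκ0 h hh s) (hw0 s)) (integrable_finsetSum _ fun k _ => hintg k)
            (Eventually.of_forall hpt)
      _ = ∑ k ∈ Finset.range (N + 1),
          4 * D * (1 / 2) ^ k * (A (2 ^ k * h) / (2 ^ k * h)) := by
          rw [integral_finsetSum _ fun k _ => hintg k]
          refine Finset.sum_congr rfl fun k _ => ?_
          rw [integral_const_mul, integral_indicator Metric.isClosed_closedBall.measurableSet]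
          simp only [hAdef]
          have : (1 / 4 : ℝ) ^ k = (1 / 2) ^ k * (1 / 2 ^ k) := by
            rw [show (1 / 4 : ℝ) = 1 / 2 * (1 / 2) by norm_num, mul_pow, one_div_pow]
          rw [this]
          field_simp
      _ ≤ _ := (hsum h hh).sum_le_tsum _ fun k _ => by
          have h3 : 0 < (2:ℝ) ^ k * h := by positivity
          have h4 : 0 ≤ A (2 ^ k * h) / (2 ^ k * h) := div_nonneg (hA0 _) h3.le
          positivity

lemma sin_lower {x M : ℝ} (hx : 0 ≤ x) (hxM : x ≤ M) (hM : M < π) :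
    2 / π * ((π - M) / π) * x ≤ Real.sin x := by
  have hpi := Real.pi_pos
  have hM0 : 0 ≤ M := hx.trans hxM
  rcases le_total x (π / 2) with h | h
  · refine le_trans ?_ (Real.mul_le_sin hx h)
    have : (π - M) / π ≤ 1 := by rw [div_le_one hpi]; linarith
    have : 2 / π * ((π - M) / π) ≤ 2 / π * 1 := by gcongr
    nlinarith
  · rw [← Real.sin_pi_sub]
    refine le_trans ?_ (Real.mul_le_sin (by linarith) (by linarith))
    rw [mul_assoc]
    have h2 : (π - M) / π * x ≤ π - x := by
      rw [div_mul_eq_mul_div, div_le_iff₀ hpi]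
      nlinarith
    gcongr

lemma chord_lower {t : ℝ} (ht : t ∈ Set.Ioo 0 (2 * π)) :
    ∃ c > 0, ∀ s ∈ Set.Ioc 0 (2 * π),
      c * |s - t| ≤ ‖Complex.exp (s * Complex.I) - Complex.exp (t * Complex.I)‖ := by
  have hpi := Real.pi_pos
  set M := max t (2 * π - t) / 2 with hM
  have hM1 : M < π := by
    have : max t (2 * π - t) < 2 * π := max_lt ht.2 (by linarith [ht.1])
    rw [hM]; linarith
  refine ⟨2 / π * ((π - M) / π), by have : 0 < π - M := by linarith
                                    positivity, ?_⟩
  intro s hs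
  have hx : |s - t| / 2 ≤ M := by
    rw [hM]
    have : |s - t| ≤ max t (2 * π - t) := by
      rw [abs_le]
      constructor
      · have := le_max_left t (2 * π - t); linarith [hs.1]
      · have := le_max_right t (2 * π - t); linarith [hs.2]
    linarith
  have h1 := sin_lower (by positivity) hx hM1
  have h2 : ‖Complex.exp (s * Complex.I) - Complex.exp (t * Complex.I)‖ =
      2 * |Real.sin ((s - t) / 2)| := by
    have e : Complex.exp (s * Complex.I) - Complex.exp (t * Complex.I) =
      Complex.exp (t * Complex.I) * (Complex.exp (Complex.I * ((s - t : ℝ) : ℂ)) - 1) := by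
      rw [mul_sub, ← Complex.exp_add]
      congr 2
      · push_cast; ring
      · ring
    rw [e, norm_mul, Complex.norm_exp_ofReal_mul_I, one_mul, Complex.norm_exp_I_mul_ofReal_sub_one]
    simp
  have h3 : |Real.sin ((s - t) / 2)| = |Real.sin (|s - t| / 2)| := by
    rcases abs_cases (s - t) with ⟨h, -⟩ | ⟨h, -⟩
    · rw [h]
    · rw [h, neg_div, Real.sin_neg, abs_neg]
  rw [h2, h3]
  have := le_abs_self (Real.sin (|s - t| / 2))
  nlinarith

lemma pK_bound {t c : ℝ} (hc : 0 < c)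
    (hcs : ∀ s ∈ Set.Ioc 0 (2 * π),
      c * |s - t| ≤ ‖Complex.exp (s * Complex.I) - Complex.exp (t * Complex.I)‖)
    {r : ℝ} (hr : 0 ≤ r) (hr1 : r < 1) {s : ℝ} (hs : s ∈ Set.Ioc 0 (2 * π)) :
    pK (circlePt r t) s ≤ (2 + 8 / c ^ 2) / (1 - r) ∧
      pK (circlePt r t) s * (s - t) ^ 2 ≤ (2 + 8 / c ^ 2) * (1 - r) := by
  have hh : 0 < 1 - r := by linarith
  constructor
  · refine (pK_le (circlePt_mem hr hr1) s).trans ?_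
    rw [norm_circlePt hr]
    gcongr
    have : 0 ≤ 8 / c ^ 2 := by positivity
    linarith
  · set d := ‖Complex.exp (s * Complex.I) - circlePt r t‖ with hd
    have hd0 : 0 < d := norm_pos_iff.2 (exp_sub_ne (circlePt_mem hr hr1) s)
    have h1 : 1 - r ≤ d := by
      have := exp_sub_lower (circlePt r t) s
      rwa [norm_circlePt hr] at this
    have h2 : ‖Complex.exp (s * Complex.I) - Complex.exp (t * Complex.I)‖ ≤ d + (1 - r) := by
      have e : Complex.exp (s * Complex.I) - Complex.exp (t * Complex.I) =
        (Complex.exp (s * Complex.I) - circlePt r t) - ((1 - r : ℝ) : ℂ) *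
          Complex.exp (t * Complex.I) := by
        unfold circlePt; push_cast; ring
      rw [e]
      refine (norm_sub_le _ _).trans ?_
      rw [norm_mul, Complex.norm_exp_ofReal_mul_I, Complex.norm_real, mul_one,
        Real.norm_of_nonneg hh.le]
    have h3 : c * |s - t| ≤ 2 * d := (hcs s hs).trans (h2.trans (by linarith))
    have h4 : c ^ 2 * (s - t) ^ 2 ≤ 4 * d ^ 2 := by
      rw [← sq_abs (s - t), ← mul_pow]
      have : (c * |s - t|) ^ 2 ≤ (2 * d) ^ 2 := by gcongr
      nlinarith
    rw [pK, norm_circlePt hr, ← hd, div_mul_eq_mul_div, div_le_iff₀ (by positivity)]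
    have h5 : (s - t) ^ 2 ≤ 4 / c ^ 2 * d ^ 2 := by
      rw [div_mul_eq_mul_div, le_div_iff₀ (by positivity)]; linarith
    have h6 : 1 - r ^ 2 ≤ 2 * (1 - r) := by nlinarith
    calc (1 - r ^ 2) * (s - t) ^ 2 ≤ (2 * (1 - r)) * (4 / c ^ 2 * d ^ 2) := by gcongr
      _ = (8 / c ^ 2) * (1 - r) * d ^ 2 := by ring
      _ ≤ _ := by gcongr; linarith

/-- Fatou's theorem for Poisson integrals of integrable functions. -/
theorem fatou_radial {u : ℝ → ℝ} (hu : Integrable u mC) :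
    ∀ᵐ t ∂mC, Tendsto (fun r => ∫ s, pK (circlePt r t) s * u s ∂mC) (𝓝[<] 1) (𝓝 (u t)) := by
  have hpi := Real.pi_pos
  set I := Set.Ioc 0 (2 * π) with hI
  have hIm : MeasurableSet I := measurableSet_Ioc
  have huI : IntegrableOn u I volume := integrable_mC_iff.1 hu
  set U := I.indicator u with hU
  have hUi : Integrable U volume := (integrable_indicator_iff hIm).2 huI
  have hLeb := IsUnifLocDoublingMeasure.ae_tendsto_average_norm_sub volume
    hUi.locallyIntegrable 1
  have hmem : ∀ᵐ t ∂(volume.restrict I), t ∈ I := ae_restrict_mem hIm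
  have hne : ∀ᵐ t ∂(volume.restrict I), t ≠ 2 * π :=
    ae_restrict_of_ae (by simp [ae_iff, measure_singleton])
  suffices h : ∀ᵐ t ∂(volume.restrict I),
      Tendsto (fun r => ∫ s, pK (circlePt r t) s * u s ∂mC) (𝓝[<] 1) (𝓝 (u t)) from
    Measure.ae_smul_measure h _
  filter_upwards [ae_restrict_of_ae hLeb, hmem, hne] with t hL htI htne
  have ht : t ∈ Set.Ioo 0 (2 * π) := ⟨htI.1, lt_of_le_of_ne htI.2 htne⟩
  obtain ⟨c, hc, hcs⟩ := chord_lower ht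
  have hUt : U t = u t := by rw [hU, indicator_of_mem htI]
  set w : ℝ → ℝ := I.indicator fun s => |u s - u t| with hw
  have hw0 : ∀ s, 0 ≤ w s := fun s => indicator_nonneg (fun s _ => abs_nonneg _) s
  have hconst : IntegrableOn (fun _ : ℝ => u t) I volume :=
    integrableOn_const (by rw [hI, Real.volume_Ioc]; exact ENNReal.ofReal_ne_top)
  have hwi : Integrable w volume :=
    (integrable_indicator_iff hIm).2 (Integrable.abs (huI.sub hconst))
  have hwU : ∀ s, w s ≤ ‖U s - U t‖ := by
    intro s
    by_cases hs : s ∈ I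
    · rw [hw, hUt, hU, indicator_of_mem hs, indicator_of_mem hs, Real.norm_eq_abs]
    · rw [hw, indicator_of_notMem hs]; exact norm_nonneg _
  have hUloc : ∀ ρ : ℝ, IntegrableOn (fun s => ‖U s - U t‖) (Metric.closedBall t ρ) volume := by
    intro ρ
    refine Integrable.norm (hUi.integrableOn.sub (integrableOn_const ?_))
    exact measure_closedBall_lt_top.ne
  have hlim : Tendsto (fun ρ => (∫ s in Metric.closedBall t ρ, w s) / ρ) (𝓝[>] 0) (𝓝 0) := by
    have h1 := hL (fun _ => t) (fun ρ : ℝ => ρ) tendsto_id (l := 𝓝[>] 0)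
      (by filter_upwards [self_mem_nhdsWithin] with ρ hρ
          have : (0:ℝ) < ρ := hρ
          exact Metric.mem_closedBall_self (by linarith))
    have h2 := h1.const_mul 2
    rw [mul_zero] at h2
    refine tendsto_of_tendsto_of_tendsto_of_le_of_le' tendsto_const_nhds h2 ?_ ?_
    · filter_upwards [self_mem_nhdsWithin] with ρ hρ
      have : (0:ℝ) < ρ := hρ
      exact div_nonneg (integral_nonneg hw0) this.le
    · filter_upwards [self_mem_nhdsWithin] with ρ hρ
      have hρ0 : (0:ℝ) < ρ := hρ
      rw [setAverage_eq]
      have hv : volume.real (Metric.closedBall t ρ) = 2 * ρ := by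
        rw [Measure.real, Real.volume_closedBall, ENNReal.toReal_ofReal (by linarith)]
      rw [hv, smul_eq_mul, mul_inv, ← mul_assoc, ← mul_assoc, mul_inv_cancel₀ two_ne_zero, one_mul,
        div_eq_inv_mul]
      gcongr
      · exact hwi.integrableOn
      · exact hUloc ρ
      · exact Metric.isClosed_closedBall.measurableSet.nullMeasurableSet
      · exact hwU _
  obtain ⟨M, hM⟩ : ∃ M, ∀ ρ > 0, ∫ s in Metric.closedBall t ρ, w s ≤ M * ρ := by
    have h1 : ∀ᶠ ρ in 𝓝[>] (0:ℝ), (∫ s in Metric.closedBall t ρ, w s) / ρ < 1 :=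
      hlim.eventually (gt_mem_nhds one_pos)
    obtain ⟨δ, hδ, hδ1⟩ := mem_nhdsGT_iff_exists_Ioo_subset.1 h1
    have hδ0 : (0:ℝ) < δ := hδ
    refine ⟨max 1 ((∫ s, w s) / δ), fun ρ hρ => ?_⟩
    rcases lt_or_ge ρ δ with h | h
    · have : (∫ s in Metric.closedBall t ρ, w s) / ρ < 1 := hδ1 ⟨hρ, h⟩
      rw [div_lt_one hρ] at this
      have h3 := le_max_left 1 ((∫ s, w s) / δ)
      nlinarith
    · have h2 : ∫ s in Metric.closedBall t ρ, w s ≤ ∫ s, w s :=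
        setIntegral_le_integral hwi (Eventually.of_forall hw0)
      have h3 := le_max_right 1 ((∫ s, w s) / δ)
      have h4 : 0 ≤ (∫ s, w s) / δ := div_nonneg (integral_nonneg hw0) hδ0.le
      have h5 : (∫ s, w s) / δ * δ = ∫ s, w s := div_mul_cancel₀ _ hδ0.ne'
      calc _ ≤ ∫ s, w s := h2
        _ = (∫ s, w s) / δ * δ := h5.symm
        _ ≤ _ := by gcongr
  set κ : ℝ → ℝ → ℝ := fun h s => if h ≤ 1 then pK (circlePt (1 - h) t) s else 0 with hκ
  have hsupp : ∀ s, w s ≠ 0 → s ∈ I := by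
    intro s hs
    by_contra h
    exact hs (by rw [hw, indicator_of_notMem h])
  have hker := kernel_lemma (t := t) (M := M) (D := 2 + 8 / c ^ 2) (R := 2 * π) hw0 hwi
    (by positivity) hM hlim (κ := κ) (by
      intro h hh s
      simp only [hκ]
      split_ifs with h1
      · exact (pK_pos (circlePt_mem (by linarith) (by linarith)) s).le
      · exact le_rfl) (by
      intro s hs
      have := hsupp s hs
      rw [abs_le]; constructor <;> linarith [this.1, this.2, ht.1, ht.2]) (by
      intro h hh s hs
      simp only [hκ]
      split_ifs with h1
      · have := pK_bound hc hcs (r := 1 - h) (by linarith) (by linarith) (hsupp s hs)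
        simpa using this
      · rw [zero_mul]
        constructor <;> positivity)
  have hT : Tendsto (fun r : ℝ => 1 - r) (𝓝[<] 1) (𝓝[>] 0) := by
    rw [tendsto_nhdsWithin_iff]
    constructor
    · have : Tendsto (fun r : ℝ => 1 - r) (𝓝 1) (𝓝 (1 - 1)) :=
        (by fun_prop : Continuous fun r : ℝ => 1 - r).tendsto _
      rw [sub_self] at this
      exact this.mono_left nhdsWithin_le_nhds
    · filter_upwards [self_mem_nhdsWithin] with r hr
      have : r < 1 := hr
      simpa using this
  have hker2 := hker.comp hT
  rw [tendsto_iff_norm_sub_tendsto_zero]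
  have hz := hker2.const_mul (2 * π)⁻¹
  rw [mul_zero] at hz
  refine tendsto_of_tendsto_of_tendsto_of_le_of_le' tendsto_const_nhds hz
    (Eventually.of_forall fun r => norm_nonneg _) ?_
  have hpos : ∀ᶠ r in 𝓝[<] (1:ℝ), 0 < r :=
    mem_nhdsWithin_of_mem_nhds (lt_mem_nhds one_pos)
  filter_upwards [self_mem_nhdsWithin, hpos] with r hr1 hr0
  have hr1' : r < 1 := hr1
  have hzm := circlePt_mem (θ := t) hr0.le hr1'
  have e1 : ∫ s, pK (circlePt r t) s * u s ∂mC - u t =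
      ∫ s, pK (circlePt r t) s * (u s - u t) ∂mC := by
    simp_rw [mul_sub]
    rw [integral_sub (integrable_pK hu hzm) ((integrable_pK_one mC hzm).mul_const _),
      integral_mul_const, integral_pK_mC hzm, one_mul]
  rw [e1]
  refine (norm_integral_le_integral_norm _).trans (le_of_eq ?_)
  rw [integral_mC, smul_eq_mul]
  congr 1
  simp only [Function.comp]
  rw [← integral_indicator hIm]
  congr 1
  ext s
  simp only [hκ, hw]
  rw [if_pos (by linarith), sub_sub_cancel]
  by_cases hs : s ∈ I
  · rw [indicator_of_mem hs, indicator_of_mem hs, norm_mul, Real.norm_of_nonneg (pK_pos hzm s).le,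
      Real.norm_eq_abs]
  · rw [indicator_of_notMem hs, indicator_of_notMem hs, mul_zero]


lemma ofReal_poisson_eq {u : ℝ → ℝ} (hu : Integrable u mC) (hu0 : ∀ t, 0 ≤ u t) {z : ℂ}
    (hz : z ∈ unitDisk) :
    ENNReal.ofReal (∫ t, pK z t * u t ∂mC) =
      ∫⁻ t, ENNReal.ofReal (pK z t) * ENNReal.ofReal (u t) ∂mC := by
  rw [ofReal_integral_eq_lintegral_ofReal (integrable_pK hu hz)]
  · congr 1
    ext t
    rw [ENNReal.ofReal_mul (pK_pos hz t).le]
  · exact Eventually.of_forall fun t => mul_nonneg (pK_pos hz t).le (hu0 t)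

lemma measurable_poisson {r : ℝ} (hr : 0 ≤ r) (hr1 : r < 1) {v : ℝ → ℝ≥0∞}
    (hv : Measurable v) :
    Measurable fun θ => ∫⁻ s, ENNReal.ofReal (pK (circlePt r θ) s) * v s ∂mC := by
  refine Measurable.lintegral_prod_right' (f := fun q : ℝ × ℝ =>
    ENNReal.ofReal (pK (circlePt r q.1) q.2) * v q.2) ?_
  exact (continuous_pK_prod hr hr1).measurable.ennreal_ofReal.mul (hv.comp measurable_snd)

lemma mC_compl_Ioc : mC (Set.Ioc 0 (2 * π))ᶜ = 0 := by
  rw [mC, Measure.smul_apply, Measure.restrict_apply measurableSet_Ioc.compl]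
  simp

lemma mC_compl_Icc : mC (Set.Icc 0 (2 * π))ᶜ = 0 :=
  measure_mono_null (compl_subset_compl.2 Ioc_subset_Icc_self) mC_compl_Ioc

/-- The Herglotz kernel as a bounded continuous function. -/
def hKb {z : ℂ} (hz : z ∈ unitDisk) : BoundedContinuousFunction ℝ ℂ :=
  BoundedContinuousFunction.ofNormedAddCommGroup (hK z) (continuous_hK hz) _ (norm_hK_le hz)

lemma integral_withDensity_hK {φ : ℝ → ℝ} (hφ : Measurable φ) (hφ0 : ∀ t, 0 ≤ φ t) (g : ℝ → ℂ) :
    ∫ t, g t ∂(mC.withDensity fun t => ENNReal.ofReal (φ t)) = ∫ t, g t * (φ t : ℂ) ∂mC := by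
  rw [integral_withDensity_eq_integral_toReal_smul hφ.ennreal_ofReal
    (Eventually.of_forall fun t => ENNReal.ofReal_lt_top)]
  congr 1
  ext t
  rw [ENNReal.toReal_ofReal (hφ0 t), Complex.real_smul, mul_comm]

lemma holder_set {p : ℝ} (hp : 1 < p) {v : ℝ → ℝ≥0∞} (hv : Measurable v) {K : ℝ≥0∞}
    (hvK : ∫⁻ t, v t ^ p ∂mC ≤ K) {G : Set ℝ} (hG : MeasurableSet G) :
    mC.withDensity v G ≤ K ^ (1 / p) * mC G ^ (1 / p.conjExponent) := by
  have hpq := Real.HolderConjugate.conjExponent hp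
  rw [withDensity_apply _ hG]
  have h := ENNReal.lintegral_mul_le_Lp_mul_Lq (mC.restrict G) hpq
    hv.aemeasurable (g := fun _ => 1) aemeasurable_const
  simp only [Pi.mul_apply, mul_one, ENNReal.one_rpow, lintegral_one, Measure.restrict_apply,
    MeasurableSet.univ, univ_inter] at h
  refine h.trans ?_
  have h2 : ∫⁻ t in G, v t ^ p ∂mC ≤ K := (setLIntegral_le_lintegral _ _).trans hvK
  have : 0 ≤ 1 / p := by have : 0 < p := by linarith
                         positivity
  gcongr

/-- Weak limits of densities bounded in `L^p`. -/
lemma weak_Lp {p : ℝ} (hp : 1 < p) (φ : ℕ → ℝ → ℝ) (hφ : ∀ n, Measurable (φ n))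
    (hφ1 : ∀ n t, 1 ≤ φ n t) (hφi : ∀ n, Integrable (φ n) mC) {K : ℝ≥0∞} (hKt : K ≠ ∞)
    (hbd : ∀ n, ∫⁻ t, ENNReal.ofReal (φ n t) ^ p ∂mC ≤ K) :
    ∃ Φ : ℝ → ℝ, Measurable Φ ∧ (∀ t, 0 ≤ Φ t) ∧ Integrable Φ mC ∧
      ∫⁻ t, ENNReal.ofReal (Φ t) ^ p ∂mC ≤ K ∧
      ∃ σ : ℕ → ℕ, StrictMono σ ∧ ∀ z ∈ unitDisk,
        Tendsto (fun n => ∫ t, hK z t * (φ (σ n) t : ℂ) ∂mC) atTop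
          (𝓝 (∫ t, hK z t * (Φ t : ℂ) ∂mC)) := by
  have hφ0 : ∀ n t, 0 ≤ φ n t := fun n t => zero_le_one.trans (hφ1 n t)
  have hp0 : 0 < p := by linarith
  have hpq := Real.HolderConjugate.conjExponent hp
  have hq0 : 0 < p.conjExponent := hpq.symm.pos
  set ν : ℕ → Measure ℝ := fun n => mC.withDensity fun t => ENNReal.ofReal (φ n t) with hν
  have hνG : ∀ n G, MeasurableSet G → ν n G ≤ K ^ (1 / p) * mC G ^ (1 / p.conjExponent) :=
    fun n G hG => holder_set hp (hφ n).ennreal_ofReal (hbd n) hG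
  have hK1 : K ^ (1 / p) ≠ ∞ := ENNReal.rpow_ne_top_of_nonneg (by positivity) hKt
  obtain ⟨C, hC⟩ : ∃ C : ℝ≥0, (C : ℝ≥0∞) = K ^ (1 / p) := ⟨_, ENNReal.coe_toNNReal hK1⟩
  obtain ⟨μ, hμf, hμs, σ, hσ, hlim, hopen⟩ := weak_compact ν C (by
      intro n
      rw [hν]
      simp only
      rw [withDensity_apply _ MeasurableSet.univ, Measure.restrict_univ]
      calc (1:ℝ≥0∞) = ∫⁻ _, 1 ∂mC := by simp
        _ ≤ _ := lintegral_mono fun t => by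
          rw [← ENNReal.ofReal_one]; exact ENNReal.ofReal_le_ofReal (hφ1 n t)) (by
      intro n
      rw [hC]
      simpa using hνG n univ MeasurableSet.univ) (by
      intro n
      exact (withDensity_absolutelyContinuous _ _) mC_compl_Icc)
  have hac : μ ≪ mC := by
    intro s hs
    have hT : Tendsto (fun ε : ℝ≥0∞ => C * (K ^ (1 / p) * ε ^ (1 / p.conjExponent)))
        (𝓝[>] 0) (𝓝 0) := by
      have h1 : Tendsto (fun ε : ℝ≥0∞ => ε ^ (1 / p.conjExponent)) (𝓝[>] 0) (𝓝 0) := by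
        have := (ENNReal.continuous_rpow_const (y := 1 / p.conjExponent)).tendsto 0
        rw [ENNReal.zero_rpow_of_pos (by positivity)] at this
        exact this.mono_left nhdsWithin_le_nhds
      have h2 := ENNReal.Tendsto.const_mul (ENNReal.Tendsto.const_mul h1 (Or.inr hK1))
        (Or.inr (ENNReal.coe_ne_top (r := C)))
      simpa using h2
    refine nonpos_iff_eq_zero.1 (ge_of_tendsto hT ?_)
    filter_upwards [self_mem_nhdsWithin] with ε hε
    have hε0 : (0:ℝ≥0∞) < ε := hε
    obtain ⟨G, hsG, hGo, hGε⟩ := s.exists_isOpen_lt_of_lt (μ := mC) ε (by rw [hs]; exact hε0)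
    refine (measure_mono hsG).trans (hopen G hGo _ fun n => ?_)
    refine (hνG n G hGo.measurableSet).trans ?_
    gcongr
  set Φ : ℝ → ℝ := fun t => (μ.rnDeriv mC t).toReal with hΦ
  have hΦm : Measurable Φ := (Measure.measurable_rnDeriv μ mC).ennreal_toReal
  have hΦ0 : ∀ t, 0 ≤ Φ t := fun t => ENNReal.toReal_nonneg
  have hΦi : Integrable Φ mC := Measure.integrable_toReal_rnDeriv
  have hlim2 : ∀ z ∈ unitDisk, Tendsto (fun n => ∫ t, hK z t * (φ (σ n) t : ℂ) ∂mC) atTop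
          (𝓝 (∫ t, hK z t * (Φ t : ℂ) ∂mC)) := by
    intro z hz
    have h1 := hlim (hKb hz)
    have e1 : ∫ t, hKb hz t ∂μ = ∫ t, hK z t * (Φ t : ℂ) ∂mC := by
      rw [← integral_rnDeriv_smul hac]
      congr 1
      ext t
      rw [Complex.real_smul, mul_comm]
      rfl
    have e2 : ∀ n, ∫ t, hKb hz t ∂(ν (σ n)) = ∫ t, hK z t * (φ (σ n) t : ℂ) ∂mC := by
      intro n
      exact integral_withDensity_hK (hφ _) (hφ0 _) (hK z)
    rw [← e1]
    simpa only [e2] using h1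
  have hlim3 : ∀ z ∈ unitDisk, Tendsto (fun n => ∫ t, pK z t * φ (σ n) t ∂mC) atTop
      (𝓝 (∫ t, pK z t * Φ t ∂mC)) := by
    intro z hz
    have := (Complex.continuous_re.tendsto _).comp (hlim2 z hz)
    rw [re_integral_hK hΦi hz] at this
    refine this.congr fun n => ?_
    exact re_integral_hK (hφi _) hz
  refine ⟨Φ, hΦm, hΦ0, hΦi, ?_, σ, hσ, hlim2⟩
  have hr : ∀ r : ℝ, 0 ≤ r → r < 1 →
      ∫⁻ θ, ENNReal.ofReal (∫ t, pK (circlePt r θ) t * Φ t ∂mC) ^ p ∂mC ≤ K := by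
    intro r hr0 hr1
    have h1 : ∀ θ, ENNReal.ofReal (∫ t, pK (circlePt r θ) t * Φ t ∂mC) ^ p =
        liminf (fun n => (∫⁻ s, ENNReal.ofReal (pK (circlePt r θ) s) *
          ENNReal.ofReal (φ (σ n) s) ∂mC) ^ p) atTop := by
      intro θ
      refine (Tendsto.liminf_eq ?_).symm
      have h2 := ((ENNReal.continuous_rpow_const (y := p)).tendsto _).comp
        ((ENNReal.continuous_ofReal.tendsto _).comp (hlim3 _ (circlePt_mem (θ := θ) hr0 hr1)))
      refine h2.congr fun n => ?_
      simp only [Function.comp]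
      rw [ofReal_poisson_eq (hφi _) (hφ0 _) (circlePt_mem hr0 hr1)]
    simp_rw [h1]
    refine (lintegral_liminf_le fun n =>
      (measurable_poisson hr0 hr1 (hφ _).ennreal_ofReal).pow_const p).trans ?_
    refine (liminf_le_limsup).trans ?_
    refine limsup_le_of_le (by isBoundedDefault) (Eventually.of_forall fun n => ?_)
    exact (poisson_Lp hp hr0 hr1 (hφ _).ennreal_ofReal.aemeasurable).trans (hbd _)
  set ρ : ℕ → ℝ := fun k => 1 - 1 / ((k:ℝ) + 1) with hρ
  have hρ0 : ∀ k, 0 ≤ ρ k := by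
    intro k
    have : 1 / ((k:ℝ) + 1) ≤ 1 := by rw [div_le_one (by positivity)]; linarith [k.cast_nonneg (α := ℝ)]
    simp only [hρ]; linarith
  have hρ1 : ∀ k, ρ k < 1 := by
    intro k
    have : 0 < 1 / ((k:ℝ) + 1) := by positivity
    simp only [hρ]; linarith
  have hρT : Tendsto ρ atTop (𝓝[<] 1) := by
    rw [tendsto_nhdsWithin_iff]
    refine ⟨?_, Eventually.of_forall hρ1⟩
    have := (tendsto_one_div_add_atTop_nhds_zero_nat (𝕜 := ℝ)).const_sub 1
    simpa [hρ] using this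
  have hae : ∀ᵐ t ∂mC, ENNReal.ofReal (Φ t) ^ p =
      liminf (fun k => ENNReal.ofReal (∫ s, pK (circlePt (ρ k) t) s * Φ s ∂mC) ^ p) atTop := by
    filter_upwards [fatou_radial hΦi] with t ht
    refine (Tendsto.liminf_eq ?_).symm
    exact ((ENNReal.continuous_rpow_const (y := p)).tendsto _).comp
        ((ENNReal.continuous_ofReal.tendsto _).comp (ht.comp hρT))
  rw [lintegral_congr_ae hae]
  refine (lintegral_liminf_le fun k => ?_).trans ?_
  · have : ∀ θ, ENNReal.ofReal (∫ s, pK (circlePt (ρ k) θ) s * Φ s ∂mC) ^ p =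
      (∫⁻ s, ENNReal.ofReal (pK (circlePt (ρ k) θ) s) * ENNReal.ofReal (Φ s) ∂mC) ^ p := by
      intro θ
      rw [ofReal_poisson_eq hΦi hΦ0 (circlePt_mem (hρ0 k) (hρ1 k))]
    simp_rw [this]
    exact (measurable_poisson (hρ0 k) (hρ1 k) hΦm.ennreal_ofReal).pow_const p
  · refine (liminf_le_limsup).trans ?_
    exact limsup_le_of_le (by isBoundedDefault) (Eventually.of_forall fun k => hr _ (hρ0 k) (hρ1 k))


/-- A sequence of radii tending to one. -/
def rad (k : ℕ) : ℝ := 1 - 1 / ((k:ℝ) + 1)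

lemma rad_nonneg (k : ℕ) : 0 ≤ rad k := by
  have : 1 / ((k:ℝ) + 1) ≤ 1 := by
    rw [div_le_one (by positivity)]; linarith [k.cast_nonneg (α := ℝ)]
  simp only [rad]; linarith

lemma rad_lt (k : ℕ) : rad k < 1 := by
  have : 0 < 1 / ((k:ℝ) + 1) := by positivity
  simp only [rad]; linarith

lemma tendsto_rad : Tendsto rad atTop (𝓝 1) := by
  have := (tendsto_one_div_add_atTop_nhds_zero_nat (𝕜 := ℝ)).const_sub 1
  have e : rad = fun k : ℕ => 1 - 1 / ((k:ℝ) + 1) := rfl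
  rw [e]
  simpa using this

lemma diffContOnCl_dilate {g : ℂ → ℂ} (hg : DifferentiableOn ℂ g unitDisk) {ρ : ℝ}
    (h0 : 0 ≤ ρ) (h1 : ρ < 1) : DiffContOnCl ℂ (fun z => g (ρ * z)) (Metric.ball 0 1) := by
  have hd : DifferentiableOn ℂ (fun z : ℂ => g (ρ * z)) (Metric.closedBall 0 1) := by
    refine hg.comp (by fun_prop) ?_
    intro z hz
    rw [mem_unitDisk, norm_mul, Complex.norm_real, Real.norm_of_nonneg h0]
    have : ‖z‖ ≤ 1 := by simpa using hz
    nlinarith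
  rw [← closure_ball (0:ℂ) one_ne_zero] at hd
  exact hd.diffContOnCl

/-- Poisson representation of the real part of a bounded holomorphic function. -/
lemma bounded_repr {g : ℂ → ℂ} (hg : DifferentiableOn ℂ g unitDisk)
    (hb : ∀ z ∈ unitDisk, ‖g z‖ ≤ 1) :
    ∃ u : ℝ → ℝ, Integrable u mC ∧ ∀ z ∈ unitDisk, (g z).re = ∫ t, pK z t * u t ∂mC := by
  set φ : ℕ → ℝ → ℝ := fun n t => (g (rad n * Complex.exp (t * Complex.I)) + 2).re with hφ
  have hmem : ∀ n (t : ℝ), (rad n * Complex.exp (t * Complex.I)) ∈ unitDisk := fun n t =>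
    circlePt_mem (rad_nonneg n) (rad_lt n)
  have hφc : ∀ n, Continuous (φ n) := by
    intro n
    refine Complex.continuous_re.comp (Continuous.add ?_ continuous_const)
    exact hg.continuousOn.comp_continuous (by fun_prop) (hmem n)
  have hφ1 : ∀ n t, 1 ≤ φ n t := by
    intro n t
    have h1 := hb _ (hmem n t)
    have h2 := Complex.abs_re_le_norm (g (rad n * Complex.exp (t * Complex.I)))
    have h3 := neg_abs_le (g (rad n * Complex.exp (t * Complex.I))).re
    simp only [hφ, Complex.add_re, Complex.re_ofNat]
    linarith
  have hφ3 : ∀ n t, φ n t ≤ 3 := by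
    intro n t
    have h1 := hb _ (hmem n t)
    have h2 := Complex.re_le_norm (g (rad n * Complex.exp (t * Complex.I)))
    simp only [hφ, Complex.add_re, Complex.re_ofNat]
    linarith
  have hφi : ∀ n, Integrable (φ n) mC := by
    intro n
    refine Integrable.of_bound (hφc n).aestronglyMeasurable 3 (Eventually.of_forall fun t => ?_)
    rw [Real.norm_of_nonneg (zero_le_one.trans (hφ1 n t))]
    exact hφ3 n t
  obtain ⟨Φ, hΦm, hΦ0, hΦi, -, σ, hσ, hlim⟩ := weak_Lp (p := 2) one_lt_two φ
    (fun n => (hφc n).measurable) hφ1 hφi (K := ENNReal.ofReal 3 ^ (2:ℝ))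
    (ENNReal.rpow_ne_top_of_nonneg (by norm_num) ENNReal.ofReal_ne_top) (by
      intro n
      calc ∫⁻ t, ENNReal.ofReal (φ n t) ^ (2:ℝ) ∂mC
          ≤ ∫⁻ _, ENNReal.ofReal 3 ^ (2:ℝ) ∂mC := by
            refine lintegral_mono fun t => ?_
            exact ENNReal.rpow_le_rpow (ENNReal.ofReal_le_ofReal (hφ3 n t)) (by norm_num)
        _ = _ := by simp)
  refine ⟨fun t => Φ t - 2, hΦi.sub (integrable_const _), fun z hz => ?_⟩
  have h1 : Tendsto (fun n => (g (rad (σ n) * z) + 2).re) atTop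
      (𝓝 (∫ t, hK z t * (Φ t : ℂ) ∂mC).re) := by
    refine ((Complex.continuous_re.tendsto _).comp (hlim z hz)).congr fun n => ?_
    have h2 := schwarz_formula (k := fun z => g (rad (σ n) * z) + 2)
      ((diffContOnCl_dilate hg (rad_nonneg _) (rad_lt _)).add diffContOnCl_const) hz
    simp only [Function.comp]
    rw [h2]
    simp [hφ]
  have h3 : Tendsto (fun n => (g (rad (σ n) * z) + 2).re) atTop (𝓝 (g z + 2).re) := by
    refine (Complex.continuous_re.tendsto _).comp (Tendsto.add ?_ tendsto_const_nhds)
    have hc : ContinuousAt g z := (hg.differentiableAt (isOpen_unitDisk.mem_nhds hz)).continuousAt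
    refine hc.tendsto.comp ?_
    have h4 : Tendsto (fun n => ((rad (σ n) : ℝ) : ℂ) * z) atTop (𝓝 (((1:ℝ) : ℂ) * z)) :=
      ((Complex.continuous_ofReal.tendsto _).comp
        (tendsto_rad.comp hσ.tendsto_atTop)).mul tendsto_const_nhds
    simpa using h4
  have h5 := tendsto_nhds_unique h1 h3
  rw [re_integral_hK hΦi hz] at h5
  simp_rw [mul_sub]
  rw [integral_sub (integrable_pK hΦi hz) ((integrable_pK_one mC hz).mul_const _),
    integral_mul_const, integral_pK_mC hz, h5]
  simp

/-- Bounded holomorphic functions have radial limits almost everywhere. -/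
lemma bounded_radial {g : ℂ → ℂ} (hg : DifferentiableOn ℂ g unitDisk)
    (hb : ∀ z ∈ unitDisk, ‖g z‖ ≤ 1) :
    ∀ᵐ t ∂mC, ∃ L : ℂ, Tendsto (fun r => g (circlePt r t)) (𝓝[<] 1) (𝓝 L) := by
  obtain ⟨u, hu, hgu⟩ := bounded_repr hg hb
  obtain ⟨v, hv, hgv⟩ := bounded_repr (g := fun z => -Complex.I * g z) (hg.const_mul _)
    (fun z hz => by simpa using hb z hz)
  filter_upwards [fatou_radial hu, fatou_radial hv] with t h1 h2
  have hpos : ∀ᶠ r in 𝓝[<] (1:ℝ), circlePt r t ∈ unitDisk := by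
    have : ∀ᶠ r in 𝓝[<] (1:ℝ), 0 < r := mem_nhdsWithin_of_mem_nhds (lt_mem_nhds one_pos)
    filter_upwards [this, self_mem_nhdsWithin] with r h0 h1 using circlePt_mem h0.le h1
  refine ⟨(u t : ℂ) + (v t : ℂ) * Complex.I, ?_⟩
  have h3 := ((Complex.continuous_ofReal.tendsto _).comp h1).add
    (((Complex.continuous_ofReal.tendsto _).comp h2).mul
      (tendsto_const_nhds (x := Complex.I)))
  refine h3.congr' ?_
  filter_upwards [hpos] with r hr
  simp only [Function.comp]
  rw [← hgu _ hr, ← hgv _ hr]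
  apply Complex.ext <;> simp

lemma outerFn_add {u v : ℝ → ℝ} (hu : Integrable u mC) (hv : Integrable v mC) {z : ℂ}
    (hz : z ∈ unitDisk) : outerFn (fun t => u t + v t) z = outerFn u z * outerFn v z := by
  have i1 : Integrable (fun t => hK z t * (u t : ℂ)) mC := integrable_hK hu.ofReal hz
  have i2 : Integrable (fun t => hK z t * (v t : ℂ)) mC := integrable_hK hv.ofReal hz
  simp only [outerFn]
  rw [← Complex.exp_add, ← integral_add i1 i2]
  congr 2
  ext t
  push_cast
  exact mul_add _ _ _

lemma eventually_circlePt_mem (t : ℝ) : ∀ᶠ r in 𝓝[<] (1:ℝ), circlePt r t ∈ unitDisk := by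
  have : ∀ᶠ r in 𝓝[<] (1:ℝ), 0 < r := mem_nhdsWithin_of_mem_nhds (lt_mem_nhds one_pos)
  filter_upwards [this, self_mem_nhdsWithin] with r h0 h1 using circlePt_mem h0.le h1

lemma outerFn_neg_radial {u : ℝ → ℝ} (hu : Integrable u mC) (h0 : ∀ t, u t ≤ 0) :
    ∀ᵐ t ∂mC, ∃ L : ℂ, Tendsto (fun r => outerFn u (circlePt r t)) (𝓝[<] 1) (𝓝 L) ∧
      ‖L‖ = Real.exp (u t) := by
  have hb : ∀ z ∈ unitDisk, ‖outerFn u z‖ ≤ 1 := by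
    intro z hz
    rw [norm_outerFn hu hz, Real.exp_le_one_iff]
    exact integral_nonpos fun t => mul_nonpos_of_nonneg_of_nonpos (pK_pos hz t).le (h0 t)
  filter_upwards [bounded_radial (differentiableOn_outerFn hu) hb, fatou_radial hu] with t h1 h2
  obtain ⟨L, hL⟩ := h1
  refine ⟨L, hL, ?_⟩
  refine tendsto_nhds_unique hL.norm (((Real.continuous_exp.tendsto _).comp h2).congr' ?_)
  filter_upwards [eventually_circlePt_mem t] with r hr
  simp only [Function.comp]
  rw [norm_outerFn hu hr]

lemma outerFn_radial {u : ℝ → ℝ} (hu : Integrable u mC) :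
    ∀ᵐ t ∂mC, ∃ L : ℂ, Tendsto (fun r => outerFn u (circlePt r t)) (𝓝[<] 1) (𝓝 L) ∧
      ‖L‖ = Real.exp (u t) := by
  have h1 : Integrable (fun t => -max (u t) 0) mC := hu.pos_part.neg
  have h2 : Integrable (fun t => -max (-u t) 0) mC := hu.neg_part.neg
  filter_upwards [outerFn_neg_radial h1 (fun t => by simp),
    outerFn_neg_radial h2 (fun t => by simp)] with t ⟨L1, hL1, hn1⟩ ⟨L2, hL2, hn2⟩
  have hL10 : L1 ≠ 0 := by
    rw [← norm_pos_iff, hn1]; positivity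
  refine ⟨L2 / L1, ?_, ?_⟩
  · refine (hL2.div hL1 hL10).congr' ?_
    filter_upwards [eventually_circlePt_mem t] with r hr
    have h3 := outerFn_add hu h1 hr
    have h4 : (fun t => u t + -max (u t) 0) = fun t => -max (-u t) 0 := by
      ext t
      rcases le_total (u t) 0 with h | h
      · rw [max_eq_right h, max_eq_left (by linarith)]; ring
      · rw [max_eq_left h, max_eq_right (by linarith)]; ring
    rw [h4] at h3
    simp only [Pi.div_apply]
    rw [h3, mul_div_assoc, div_self, mul_one]
    exact Complex.exp_ne_zero _
  · rw [norm_div, hn1, hn2, ← Real.exp_sub]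
    congr 1
    rcases le_total (u t) 0 with h | h
    · rw [max_eq_right h, max_eq_left (by linarith)]; ring
    · rw [max_eq_left h, max_eq_right (by linarith)]; ring

lemma log_radialLimit {u : ℝ → ℝ} (hu : Integrable u mC) {ω : ℂ} (hω : ‖ω‖ = 1) :
    ∀ᵐ t ∂mC, Real.log ‖radialLimit (fun z => ω * outerFn u z) t‖ = u t := by
  filter_upwards [outerFn_radial hu] with t ⟨L, hL, hn⟩
  have : radialLimit (fun z => ω * outerFn u z) t = ω * L :=
    Tendsto.limUnder_eq (hL.const_mul ω)
  rw [this, norm_mul, hω, one_mul, hn, Real.log_exp]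

lemma outerFn_congr {u v : ℝ → ℝ} (h : u =ᵐ[mC] v) (z : ℂ) : outerFn u z = outerFn v z := by
  unfold outerFn
  congr 1
  refine integral_congr_ae ?_
  filter_upwards [h] with t ht
  rw [ht]

lemma isOuter_outerFn {u : ℝ → ℝ} (hu : Integrable u mC) {ω : ℂ} (hω : ‖ω‖ = 1) :
    IsOuter (fun z => ω * outerFn u z) := by
  have h := log_radialLimit hu hω
  refine isOuter_iff.2 ⟨ω, hω, hu.congr (h.mono fun t ht => ht.symm), fun z hz => ?_⟩
  congr 1
  exact outerFn_congr (h.mono fun t ht => ht.symm) z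


/-- Admissible zero data for a Blaschke product. -/
def BlData {ι : Type*} (a : ι → ℂ) : Prop :=
  (∀ i, a i ∈ unitDisk ∧ a i ≠ 0) ∧ Summable (fun i => 1 - ‖a i‖)

/-- The Blaschke product without the power of `z`. -/
def blP {ι : Type*} (a : ι → ℂ) (z : ℂ) : ℂ := ∏' i, blaschkeFactor (a i) z

lemma bl_den_ne {a z : ℂ} (ha : ‖a‖ ≤ 1) :
    1 - ‖z‖ ≤ ‖1 - (starRingEnd ℂ) a * z‖ := by
  have h1 : ‖(starRingEnd ℂ) a * z‖ ≤ ‖z‖ := by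
    rw [norm_mul, RCLike.norm_conj]
    exact mul_le_of_le_one_left (norm_nonneg _) ha
  have h2 := norm_sub_norm_le 1 ((starRingEnd ℂ) a * z)
  rw [norm_one] at h2
  linarith

lemma bl_den_ne_zero {a z : ℂ} (ha : ‖a‖ ≤ 1) (hz : z ∈ unitDisk) :
    1 - (starRingEnd ℂ) a * z ≠ 0 := by
  rw [← norm_pos_iff]
  rw [mem_unitDisk] at hz
  linarith [bl_den_ne (z := z) ha]

lemma bl_sub_one_le {a z : ℂ} (ha : ‖a‖ ≤ 1) (ha0 : a ≠ 0) (hz : z ∈ unitDisk) :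
    ‖blaschkeFactor a z - 1‖ ≤ (1 - ‖a‖) * (2 / (1 - ‖z‖)) := by
  have hd := bl_den_ne_zero ha hz
  have hd1 := bl_den_ne (z := z) ha
  have hz1 : ‖z‖ < 1 := mem_unitDisk.1 hz
  have hsq : (starRingEnd ℂ) a * a = (‖a‖ : ℂ) ^ 2 := by
    exact Complex.conj_mul' a
  have h : blaschkeFactor a z - 1 =
      -((1 - (‖a‖:ℂ)) * ((a + ‖a‖ * z) / a * (1 / (1 - (starRingEnd ℂ) a * z)))) := by
    unfold blaschkeFactor
    obtain ⟨D, hD⟩ : ∃ D, D = 1 - (starRingEnd ℂ) a * z := ⟨_, rfl⟩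
    rw [← hD] at hd ⊢
    field_simp
    linear_combination (-a) * hD + z * hsq
  rw [h, norm_neg, norm_mul, norm_mul, norm_div, norm_div, norm_one]
  have e1 : ‖(1 - (‖a‖:ℂ))‖ = 1 - ‖a‖ := by
    rw [← Complex.ofReal_one, ← Complex.ofReal_sub, Complex.norm_real, Real.norm_of_nonneg]
    linarith
  have ha' : 0 < ‖a‖ := norm_pos_iff.2 ha0
  have e2 : ‖a + ‖a‖ * z‖ / ‖a‖ ≤ 2 := by
    rw [div_le_iff₀ ha']
    calc ‖a + ‖a‖ * z‖ ≤ ‖a‖ + ‖(‖a‖ : ℂ) * z‖ := norm_add_le _ _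
      _ = ‖a‖ + ‖a‖ * ‖z‖ := by rw [norm_mul, Complex.norm_real, norm_norm]
      _ ≤ 2 * ‖a‖ := by nlinarith
  rw [e1]
  refine mul_le_mul_of_nonneg_left ?_ (by linarith)
  rw [div_eq_mul_one_div 2]
  refine mul_le_mul e2 ?_ (by positivity) (by norm_num)
  exact one_div_le_one_div_of_le (by linarith) hd1

lemma bl_norm_le_one {a z : ℂ} (ha : ‖a‖ ≤ 1) (hz : ‖z‖ ≤ 1) : ‖blaschkeFactor a z‖ ≤ 1 := by
  have h1 : ‖a - z‖ ≤ ‖1 - (starRingEnd ℂ) a * z‖ := by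
    refine le_of_sq_le_sq ?_ (norm_nonneg _)
    rw [← Complex.normSq_eq_norm_sq, ← Complex.normSq_eq_norm_sq]
    have ha2 : Complex.normSq a ≤ 1 := by
      rw [Complex.normSq_eq_norm_sq]; exact pow_le_one₀ (norm_nonneg _) ha
    have hz2 : Complex.normSq z ≤ 1 := by
      rw [Complex.normSq_eq_norm_sq]; exact pow_le_one₀ (norm_nonneg _) hz
    simp only [Complex.normSq_apply, Complex.sub_re, Complex.sub_im, Complex.mul_re,
      Complex.mul_im, Complex.conj_re, Complex.conj_im, Complex.one_re, Complex.one_im] at *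
    nlinarith
  unfold blaschkeFactor
  rw [norm_mul, norm_div, norm_div, Complex.norm_real, norm_norm]
  exact mul_le_one₀ (div_self_le_one _) (by positivity) (div_le_one_of_le₀ h1 (norm_nonneg _))

lemma bl_eq_zero {a z : ℂ} (ha : a ∈ unitDisk) (ha0 : a ≠ 0) (hz : z ∈ unitDisk) :
    blaschkeFactor a z = 0 ↔ a = z := by
  have hd := bl_den_ne_zero (mem_unitDisk.1 ha).le hz
  simp [blaschkeFactor, ha0, hd, sub_eq_zero]

lemma bl_diff {a : ℂ} (ha : a ∈ unitDisk) :
    DifferentiableOn ℂ (blaschkeFactor a) unitDisk := by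
  unfold blaschkeFactor
  refine DifferentiableOn.const_mul (DifferentiableOn.div (by fun_prop) (by fun_prop) ?_) _
  intro z hz
  exact bl_den_ne_zero (mem_unitDisk.1 ha).le hz

section
variable {ι : Type*} {a : ι → ℂ}

lemma bl_summable (h : BlData a) {z : ℂ} (hz : z ∈ unitDisk) :
    Summable (fun i => ‖blaschkeFactor (a i) z - 1‖) :=
  Summable.of_nonneg_of_le (fun _ => norm_nonneg _)
    (fun i => bl_sub_one_le (mem_unitDisk.1 (h.1 i).1).le (h.1 i).2 hz) (h.2.mul_right _)

lemma bl_multipliable (h : BlData a) {z : ℂ} (hz : z ∈ unitDisk) :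
    Multipliable (fun i => blaschkeFactor (a i) z) := by
  simpa using multipliable_one_add_of_summable (bl_summable h hz)

lemma blP_norm_le (h : BlData a) {z : ℂ} (hz : z ∈ unitDisk) : ‖blP a z‖ ≤ 1 := by
  have ht : Tendsto (fun s : Finset ι => ∏ i ∈ s, blaschkeFactor (a i) z) atTop (𝓝 (blP a z)) :=
    (bl_multipliable h hz).hasProd
  refine le_of_tendsto ht.norm (Eventually.of_forall fun s => ?_)
  rw [norm_prod]
  exact Finset.prod_le_one (fun i _ => norm_nonneg _) fun i _ =>
    bl_norm_le_one (mem_unitDisk.1 (h.1 i).1).le (mem_unitDisk.1 hz).le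

lemma blP_ne_zero (h : BlData a) {z : ℂ} (hz : z ∈ unitDisk) (hne : ∀ i, a i ≠ z) :
    blP a z ≠ 0 := by
  have := tprod_one_add_ne_zero_of_summable (f := fun i => blaschkeFactor (a i) z - 1)
    (fun i => by
      simpa using (not_congr (bl_eq_zero (h.1 i).1 (h.1 i).2 hz)).2 (hne i)) (bl_summable h hz)
  simpa [blP] using this

lemma blP_diff (h : BlData a) : DifferentiableOn ℂ (blP a) unitDisk := by
  have hp : HasProdLocallyUniformlyOn (fun i z => 1 + (blaschkeFactor (a i) z - 1))
      (fun z => ∏' i, (1 + (blaschkeFactor (a i) z - 1))) unitDisk := by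
    refine hasProdLocallyUniformlyOn_of_forall_compact isOpen_unitDisk ?_
    intro K hKs hKc
    rcases K.eq_empty_or_nonempty with hN | hN
    · simpa [hasProdUniformlyOn_iff_tendstoUniformlyOn, hN] using tendstoUniformlyOn_empty
    · obtain ⟨q, hq, HB⟩ := hKc.exists_isMaxOn hN
        (show ContinuousOn (fun q : ℂ => ‖q‖) K by fun_prop)
      have hq1 : ‖q‖ < 1 := mem_unitDisk.1 (hKs hq)
      refine (h.2.mul_right (2 / (1 - ‖q‖))).hasProdUniformlyOn_one_add hKc
        (.of_forall fun n x hx => ?_) (fun i => ?_)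
      · have hx1 : ‖x‖ ≤ ‖q‖ := HB hx
        have ha1 := mem_unitDisk.1 (h.1 n).1
        refine (bl_sub_one_le ha1.le (h.1 n).2 (hKs hx)).trans ?_
        refine mul_le_mul_of_nonneg_left ?_ (by linarith)
        exact div_le_div_of_nonneg_left (by norm_num) (by linarith) (by linarith)
      · exact ((bl_diff (h.1 i).1).continuousOn.mono hKs).sub continuousOn_const
  have := hp.differentiableOn (.of_forall fun s => by
    exact DifferentiableOn.fun_finsetProd fun i _ => by
      simpa using bl_diff (h.1 i).1) isOpen_unitDisk
  have e : blP a = fun z => ∏' i, (1 + (blaschkeFactor (a i) z - 1)) := by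
    ext z
    simp [blP]
  rw [e]
  exact this

lemma bl_fiber_finite (h : BlData a) {w : ℂ} (hw : w ∈ unitDisk) : {i | a i = w}.Finite := by
  have h1 := h.2.tendsto_cofinite_zero
  have hw1 : 0 < 1 - ‖w‖ := by linarith [mem_unitDisk.1 hw]
  have h2 := h1.eventually (gt_mem_nhds hw1)
  rw [eventually_cofinite] at h2
  refine h2.subset fun i hi => ?_
  simp only [mem_ofPred_eq] at hi ⊢
  rw [hi]; exact lt_irrefl _

lemma bl_order {w : ℂ} (hw : w ∈ unitDisk) (hw0 : w ≠ 0) :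
    analyticOrderAt (blaschkeFactor w) w = 1 := by
  have ha : AnalyticAt ℂ (blaschkeFactor w) w :=
    (bl_diff hw).analyticAt (isOpen_unitDisk.mem_nhds hw)
  have hd := bl_den_ne_zero (mem_unitDisk.1 hw).le hw
  have := (ha.analyticOrderAt_eq_natCast (n := 1)).2
    ⟨fun z => -((‖w‖ : ℂ) / w) * (1 / (1 - (starRingEnd ℂ) w * z)), ?_, ?_, ?_⟩
  · simpa using this
  · exact analyticAt_const.mul (analyticAt_const.div (by fun_prop) hd)
  · simp [hw0, hd]
  · refine Eventually.of_forall fun z => ?_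
    simp only [blaschkeFactor, smul_eq_mul]
    ring

lemma blP_split (h : BlData a) (s : Finset ι) {z : ℂ} (hz : z ∈ unitDisk) :
    blP a z = (∏ i ∈ s, blaschkeFactor (a i) z) * blP (fun i : {i // i ∉ s} => a i) z := by
  unfold blP
  have h1 : Multipliable (fun i : {i // i ∉ s} => blaschkeFactor (a i) z) :=
    bl_multipliable (a := fun i : {i // i ∉ s} => a i)
      ⟨fun i => h.1 i, h.2.subtype _⟩ hz
  have h2 : Multipliable (fun i : (s : Set ι) => blaschkeFactor (a i) z) :=
    (hasProd_fintype _ _).multipliable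
  have := Multipliable.tprod_mul_tprod_compl (f := fun i => blaschkeFactor (a i) z)
    (s := (s : Set ι)) h2 h1
  rw [← this]
  congr 1
  exact Finset.tprod_subtype s (fun i => blaschkeFactor (a i) z)

lemma blP_order (h : BlData a) {w : ℂ} (hw : w ∈ unitDisk) (hw0 : w ≠ 0) :
    analyticOrderAt (blP a) w = Nat.card {i // a i = w} := by
  classical
  have hfin := bl_fiber_finite h hw
  set s := hfin.toFinset with hs
  have hsub : BlData (fun i : {i // i ∉ s} => a i) := ⟨fun i => h.1 i, h.2.subtype _⟩
  have hcard : Nat.card {i // a i = w} = s.card := by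
    rw [hs, ← Set.ncard_eq_toFinset_card _ hfin]; rfl
  have he : blP a =ᶠ[𝓝 w] (blaschkeFactor w) ^ s.card * blP (fun i : {i // i ∉ s} => a i) := by
    filter_upwards [isOpen_unitDisk.mem_nhds hw] with z hz
    rw [blP_split h s hz, Pi.mul_apply, Pi.pow_apply]
    congr 1
    rw [Finset.prod_congr rfl (g := fun _ => blaschkeFactor w z), Finset.prod_const]
    intro i hi
    rw [hs, Set.Finite.mem_toFinset] at hi
    rw [show a i = w from hi]
  have A1 : AnalyticAt ℂ (blaschkeFactor w) w :=
    (bl_diff hw).analyticAt (isOpen_unitDisk.mem_nhds hw)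
  have A2 : AnalyticAt ℂ (blP (fun i : {i // i ∉ s} => a i)) w :=
    (blP_diff hsub).analyticAt (isOpen_unitDisk.mem_nhds hw)
  have A3 : analyticOrderAt (blP (fun i : {i // i ∉ s} => a i)) w = 0 := by
    rw [A2.analyticOrderAt_eq_zero]
    exact blP_ne_zero hsub hw fun i hi => i.2 (hfin.mem_toFinset.2 hi)
  rw [analyticOrderAt_congr he, analyticOrderAt_mul (A1.pow _) A2, analyticOrderAt_pow A1,
    bl_order hw hw0, A3, hcard]
  simp

end

lemma isBlaschke_iff {B : ℂ → ℂ} : IsBlaschkeProduct B →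
    ∃ (m : ℕ) (ι : Type) (_ : Countable ι) (a : ι → ℂ), BlData a ∧
      ∀ z ∈ unitDisk, B z = z ^ m * blP a z := by
  rintro ⟨m, ⟨n, a, ha, hB⟩ | ⟨a, ha, hs, hB⟩⟩
  · refine ⟨m, Fin n, inferInstance, fun i => a i, ⟨fun i => ha i i.2, ?_⟩, fun z hz => ?_⟩
    · exact (hasSum_fintype _ _).summable
    · rw [hB z hz, blP, tprod_fintype, Fin.prod_univ_eq_prod_range
        (fun k => blaschkeFactor (a k) z)]
  · exact ⟨m, ℕ, inferInstance, a, ⟨ha, hs⟩, hB⟩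

lemma blP_equiv {ι κ : Type*} (e : κ ≃ ι) (a : ι → ℂ) (z : ℂ) :
    blP (a ∘ e) z = blP a z := by
  unfold blP
  exact e.tprod_eq (fun i => blaschkeFactor (a i) z)

lemma isBlaschke_of {B : ℂ → ℂ} (m : ℕ) {ι : Type} [Countable ι] {a : ι → ℂ} (h : BlData a)
    (hB : ∀ z ∈ unitDisk, B z = z ^ m * blP a z) : IsBlaschkeProduct B := by
  refine ⟨m, ?_⟩
  rcases finite_or_infinite ι with hf | hi
  · left
    obtain ⟨n, ⟨e⟩⟩ := Finite.exists_equiv_fin ι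
    refine ⟨n, fun k => if hk : k < n then a (e.symm ⟨k, hk⟩) else 0, ?_, ?_⟩
    · intro k hk
      simp only [hk, dite_true]
      exact h.1 _
    · intro z hz
      rw [hB z hz, ← blP_equiv e.symm, blP, tprod_fintype,
        ← Fin.prod_univ_eq_prod_range]
      simp
  · right
    obtain ⟨e⟩ : Nonempty (ℕ ≃ ι) := by
      obtain ⟨_⟩ := nonempty_denumerable ι
      exact ⟨(Denumerable.eqv ι).symm⟩
    refine ⟨a ∘ e, fun k => h.1 _, (e.summable_iff (f := fun i => 1 - ‖a i‖)).2 h.2, ?_⟩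
    intro z hz
    rw [hB z hz, ← blP_equiv e]
    rfl

/-- Full Blaschke product order at the origin. -/
lemma blP_order_zero {ι : Type*} {a : ι → ℂ} (h : BlData a) (m : ℕ) {B : ℂ → ℂ}
    (hB : ∀ z ∈ unitDisk, B z = z ^ m * blP a z) : analyticOrderAt B 0 = m := by
  have h0 : (0:ℂ) ∈ unitDisk := by simp [mem_unitDisk]
  have A2 : AnalyticAt ℂ (blP a) 0 := (blP_diff h).analyticAt (isOpen_unitDisk.mem_nhds h0)
  have he : B =ᶠ[𝓝 0] (id : ℂ → ℂ) ^ m * blP a := by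
    filter_upwards [isOpen_unitDisk.mem_nhds h0] with z hz
    rw [hB z hz]; rfl
  have A3 : analyticOrderAt (blP a) 0 = 0 := by
    rw [A2.analyticOrderAt_eq_zero]
    exact blP_ne_zero h h0 fun i => (h.1 i).2
  rw [analyticOrderAt_congr he, analyticOrderAt_mul (analyticAt_id.pow m) A2, A3,
    analyticOrderAt_pow analyticAt_id]
  simp

lemma blP_order_ne {ι : Type*} {a : ι → ℂ} (h : BlData a) (m : ℕ) {B : ℂ → ℂ}
    (hB : ∀ z ∈ unitDisk, B z = z ^ m * blP a z) {w : ℂ} (hw : w ∈ unitDisk) (hw0 : w ≠ 0) :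
    analyticOrderAt B w = Nat.card {i // a i = w} := by
  have A2 : AnalyticAt ℂ (blP a) w := (blP_diff h).analyticAt (isOpen_unitDisk.mem_nhds hw)
  have he : B =ᶠ[𝓝 w] (id : ℂ → ℂ) ^ m * blP a := by
    filter_upwards [isOpen_unitDisk.mem_nhds hw] with z hz
    rw [hB z hz]; rfl
  have A3 : analyticOrderAt (id : ℂ → ℂ) w = 0 := by
    rw [analyticAt_id.analyticOrderAt_eq_zero]
    exact hw0
  rw [analyticOrderAt_congr he, analyticOrderAt_mul (analyticAt_id.pow m) A2,
    analyticOrderAt_pow analyticAt_id, blP_order h hw hw0, A3]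
  simp

/-- Blaschke products with the same zero orders agree. -/
lemma blaschke_unique {B B' : ℂ → ℂ} (hB : IsBlaschkeProduct B) (hB' : IsBlaschkeProduct B')
    (ho : ∀ w ∈ unitDisk, analyticOrderAt B w = analyticOrderAt B' w) :
    Set.EqOn B B' unitDisk := by
  obtain ⟨m, ι, _, a, ha, hBa⟩ := isBlaschke_iff hB
  obtain ⟨m', ι', _, a', ha', hBa'⟩ := isBlaschke_iff hB'
  have h0 : (0:ℂ) ∈ unitDisk := by simp [mem_unitDisk]
  have hm : m = m' := by
    have := ho 0 h0
    rw [blP_order_zero ha m hBa, blP_order_zero ha' m' hBa'] at this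
    exact_mod_cast this
  have hc : ∀ w : ℂ, Nonempty ({i // a i = w} ≃ {i // a' i = w}) := by
    intro w
    by_cases hw : w ∈ unitDisk ∧ w ≠ 0
    · have h1 := ho w hw.1
      rw [blP_order_ne ha m hBa hw.1 hw.2, blP_order_ne ha' m' hBa' hw.1 hw.2] at h1
      have h2 : Nat.card {i // a i = w} = Nat.card {i // a' i = w} := by exact_mod_cast h1
      have : Finite {i // a i = w} := (bl_fiber_finite ha hw.1).to_subtype
      have : Finite {i // a' i = w} := (bl_fiber_finite ha' hw.1).to_subtype
      exact Finite.card_eq.1 h2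
    · have : IsEmpty {i // a i = w} := ⟨fun i => hw (by
        have := ha.1 i.1; rwa [i.2] at this)⟩
      have : IsEmpty {i // a' i = w} := ⟨fun i => hw (by
        have := ha'.1 i.1; rwa [i.2] at this)⟩
      exact ⟨Equiv.equivOfIsEmpty _ _⟩
  let e0 := fun w => (hc w).some
  let e : ι ≃ ι' := (Equiv.sigmaFiberEquiv a).symm.trans
    ((Equiv.sigmaCongrRight fun w => (e0 w)).trans (Equiv.sigmaFiberEquiv a'))
  have he : a' ∘ e = a := by
    ext i
    exact (e0 (a i) ⟨i, rfl⟩).2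
  intro z hz
  rw [hBa z hz, hBa' z hz, hm, ← blP_equiv e a', he]

lemma blaschke_diff {B : ℂ → ℂ} (hB : IsBlaschkeProduct B) : DifferentiableOn ℂ B unitDisk := by
  obtain ⟨m, ι, _, a, ha, hBa⟩ := isBlaschke_iff hB
  exact (((differentiable_id.pow m).differentiableOn).mul (blP_diff ha)).congr hBa

lemma blaschke_norm_le {B : ℂ → ℂ} (hB : IsBlaschkeProduct B) :
    ∀ z ∈ unitDisk, ‖B z‖ ≤ 1 := by
  obtain ⟨m, ι, _, a, ha, hBa⟩ := isBlaschke_iff hB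
  intro z hz
  rw [hBa z hz, norm_mul, norm_pow]
  exact mul_le_one₀ (pow_le_one₀ (norm_nonneg _) (mem_unitDisk.1 hz).le) (norm_nonneg _)
    (blP_norm_le ha hz)


/-- A nonvanishing holomorphic function on a ball has a holomorphic logarithm. -/
lemma exists_holo_log {h : ℂ → ℂ} {ρ : ℝ} (hρ : 0 < ρ)
    (hd : DifferentiableOn ℂ h (Metric.ball 0 ρ)) (h0 : ∀ z ∈ Metric.ball 0 ρ, h z ≠ 0) :
    ∃ k : ℂ → ℂ, DifferentiableOn ℂ k (Metric.ball 0 ρ) ∧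
      ∀ z ∈ Metric.ball 0 ρ, h z = Complex.exp (k z) := by
  have hd' : DifferentiableOn ℂ (fun z => deriv h z / h z) (Metric.ball 0 ρ) :=
    (hd.deriv Metric.isOpen_ball).div hd h0
  obtain ⟨k, hk⟩ := hd'.isExactOn_ball
  have hkd : DifferentiableOn ℂ k (Metric.ball 0 ρ) := fun z hz =>
    (hk z hz).differentiableAt.differentiableWithinAt
  have hder : ∀ z ∈ Metric.ball (0:ℂ) ρ,
      HasDerivAt (fun z => h z * Complex.exp (-k z)) 0 z := by
    intro z hz
    have h1 : HasDerivAt h (deriv h z) z :=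
      (hd.differentiableAt (Metric.isOpen_ball.mem_nhds hz)).hasDerivAt
    have h2 := h1.mul ((hk z hz).neg.cexp)
    have hz0 := h0 z hz
    have e : deriv h z * Complex.exp (-k z) +
        h z * (Complex.exp (-k z) * -(deriv h z / h z)) = 0 := by
      generalize Complex.exp (-k z) = E
      field_simp
      ring
    exact e ▸ h2
  have hconst : ∀ z ∈ Metric.ball (0:ℂ) ρ,
      h z * Complex.exp (-k z) = h 0 * Complex.exp (-k 0) := by
    intro z hz
    refine (convex_ball (0:ℂ) ρ).is_const_of_fderivWithin_eq_zero (𝕜 := ℂ)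
      (f := fun z => h z * Complex.exp (-k z)) (fun w hw =>
        (hder w hw).differentiableAt.differentiableWithinAt) (fun w hw => ?_) hz
        (Metric.mem_ball_self hρ)
    rw [fderivWithin_of_isOpen Metric.isOpen_ball hw]
    have := (hder w hw).hasFDerivAt.fderiv
    rw [this]
    ext
    simp
  set c := h 0 * Complex.exp (-k 0) with hc
  have hc0 : c ≠ 0 := mul_ne_zero (h0 0 (Metric.mem_ball_self hρ)) (Complex.exp_ne_zero _)
  refine ⟨fun z => k z + Complex.log c, hkd.add_const _, fun z hz => ?_⟩
  rw [Complex.exp_add, Complex.exp_log hc0, ← hconst z hz, Complex.exp_neg]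
  field_simp [Complex.exp_ne_zero]

/-- Finitely many zeros can be factored out. -/
lemma finite_factor {U : Set ℂ} (hU : IsOpen U) {g : ℂ → ℂ} (hg : DifferentiableOn ℂ g U)
    (S : Finset ℂ) (hS : ∀ a ∈ S, a ∈ U ∧ analyticOrderAt g a ≠ ⊤) :
    ∃ h : ℂ → ℂ, DifferentiableOn ℂ h U ∧ (∀ a ∈ S, h a ≠ 0) ∧
      ∀ z ∈ U, g z = (∏ a ∈ S, (z - a) ^ analyticOrderNatAt g a) * h z := by
  classical
  induction S using Finset.induction_on with
  | empty => exact ⟨g, hg, by simp, by simp⟩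
  | insert a S haS ih =>
    obtain ⟨h, hh, hne, hgh⟩ := ih fun b hb => hS b (Finset.mem_insert_of_mem hb)
    obtain ⟨haU, hatop⟩ := hS a (Finset.mem_insert_self _ _)
    have hnhds := hU.mem_nhds haU
    have hha : AnalyticAt ℂ h a := hh.analyticAt hnhds
    set P : ℂ → ℂ := fun z => ∏ b ∈ S, (z - b) ^ analyticOrderNatAt g b with hP
    have hPd : Differentiable ℂ P := by
      rw [hP]
      exact Differentiable.fun_finsetProd fun b _ => by fun_prop
    have hPa : AnalyticAt ℂ P a := hPd.analyticAt a
    have hP0 : P a ≠ 0 := by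
      rw [hP]
      exact Finset.prod_ne_zero_iff.2 fun b hb => pow_ne_zero _
        (sub_ne_zero.2 fun hab => haS (hab ▸ hb))
    have hord : analyticOrderAt h a = (analyticOrderNatAt g a : ℕ∞) := by
      have he : g =ᶠ[𝓝 a] P * h := by
        filter_upwards [hnhds] with z hz using hgh z hz
      rw [Nat.cast_analyticOrderNatAt hatop, analyticOrderAt_congr he,
        analyticOrderAt_mul hPa hha, hPa.analyticOrderAt_eq_zero.2 hP0, zero_add]
    set n := analyticOrderNatAt g a with hn
    obtain ⟨k0, hk0, hk00, hk0e⟩ := hha.analyticOrderAt_eq_natCast.1 hord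
    set k : ℂ → ℂ := fun z => if z = a then k0 a else h z / (z - a) ^ n with hk
    have hkk0 : k =ᶠ[𝓝 a] k0 := by
      filter_upwards [hk0e] with z hz
      by_cases hza : z = a
      · simp [hk, hza]
      · have : (z - a) ^ n ≠ 0 := pow_ne_zero _ (sub_ne_zero.2 hza)
        simp only [hk, hza, if_false, hz, smul_eq_mul]
        field_simp
    have hhk : ∀ z ∈ U, h z = (z - a) ^ n * k z := by
      intro z hz
      by_cases hza : z = a
      · have := hk0e.self_of_nhds
        simp only [smul_eq_mul] at this
        rw [hza, this]
        simp [hk]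
      · have : (z - a) ^ n ≠ 0 := pow_ne_zero _ (sub_ne_zero.2 hza)
        simp only [hk, hza, if_false]
        field_simp
    refine ⟨k, ?_, ?_, ?_⟩
    · intro z hz
      by_cases hza : z = a
      · rw [hza]
        exact (hk0.differentiableAt.congr_of_eventuallyEq hkk0).differentiableWithinAt
      · have hzn : (z - a) ^ n ≠ 0 := pow_ne_zero _ (sub_ne_zero.2 hza)
        have h1 : DifferentiableAt ℂ (fun z => h z / (z - a) ^ n) z :=
          (hh.differentiableAt (hU.mem_nhds hz)).div (by fun_prop) hzn
        refine (h1.congr_of_eventuallyEq ?_).differentiableWithinAt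
        filter_upwards [isOpen_ne.mem_nhds hza] with w hw
        exact if_neg hw
    · intro b hb
      rcases Finset.mem_insert.1 hb with rfl | hb'
      · simpa [hk] using hk00
      · have h1 := hne b hb'
        rw [hhk b (hS b hb).1] at h1
        exact right_ne_zero_of_mul h1
    · intro z hz
      rw [hgh z hz, hhk z hz, Finset.prod_insert haS]
      ring

section
variable {g : ℂ → ℂ}

lemma zeros_finite (hg : DifferentiableOn ℂ g unitDisk) (hg0 : g 0 ≠ 0) {s : ℝ} (hs : s < 1) :
    {z | ‖z‖ ≤ s ∧ g z = 0}.Finite := by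
  by_contra hinf
  have hsub : {z | ‖z‖ ≤ s ∧ g z = 0} ⊆ Metric.closedBall (0:ℂ) s := fun z hz => by
    simpa using hz.1
  obtain ⟨x, hx, hacc⟩ := Set.Infinite.exists_accPt_of_subset_isCompact hinf
    (isCompact_closedBall (0:ℂ) s) hsub
  have hxd : x ∈ unitDisk := by
    rw [mem_unitDisk]
    have : ‖x‖ ≤ s := by simpa using hx
    linarith
  rw [accPt_iff_frequently_nhdsNE] at hacc
  have := (hg.analyticOnNhd isOpen_unitDisk).eqOn_zero_of_preconnected_of_frequently_eq_zero
    (convex_ball (0:ℂ) 1).isPreconnected hxd (hacc.mono fun z hz => hz.2)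
  exact hg0 (this (by simp [mem_unitDisk]))

lemma order_ne_top (hg : DifferentiableOn ℂ g unitDisk) (hg0 : g 0 ≠ 0) {a : ℂ}
    (ha : a ∈ unitDisk) : analyticOrderAt g a ≠ ⊤ := by
  have h0 : (0:ℂ) ∈ unitDisk := by simp [mem_unitDisk]
  have hA := hg.analyticOnNhd isOpen_unitDisk
  refine hA.analyticOrderAt_ne_top_of_isPreconnected (convex_ball (0:ℂ) 1).isPreconnected h0 ha ?_
  rw [(hA 0 h0).analyticOrderAt_eq_zero.2 hg0]
  simp

end

/-- The zeros of `g` in the disk. -/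
abbrev ZS (g : ℂ → ℂ) : Type := {a : ℂ // a ∈ unitDisk ∧ g a = 0}

/-- The index set of zeros of `g` counted with multiplicity. -/
abbrev ZI (g : ℂ → ℂ) : Type := Σ a : ZS g, Fin (analyticOrderNatAt g a)

/-- The zero with a given index. -/
def zf (g : ℂ → ℂ) (i : ZI g) : ℂ := i.1.1

section
variable {g : ℂ → ℂ}

lemma zf_mem (i : ZI g) : zf g i ∈ unitDisk := i.1.2.1

lemma zf_ne (hg0 : g 0 ≠ 0) (i : ZI g) : zf g i ≠ 0 := fun h => hg0 (by
  have := i.1.2.2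
  rwa [show (i.1 : ℂ) = 0 from h] at this)

lemma ZS_finite (hg : DifferentiableOn ℂ g unitDisk) (hg0 : g 0 ≠ 0) {s : ℝ} (hs : s < 1) :
    {a : ZS g | ‖(a:ℂ)‖ ≤ s}.Finite := by
  refine Set.Finite.of_finite_image ((zeros_finite hg hg0 hs).subset ?_)
    Subtype.val_injective.injOn
  rintro _ ⟨a, ha, rfl⟩
  exact ⟨ha, a.2.2⟩

lemma ZS_countable (hg : DifferentiableOn ℂ g unitDisk) (hg0 : g 0 ≠ 0) : Countable (ZS g) := by
  rw [← Set.countable_univ_iff]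
  have : (Set.univ : Set (ZS g)) = ⋃ n : ℕ, {a : ZS g | ‖(a:ℂ)‖ ≤ rad n} := by
    ext a
    simp only [mem_univ, mem_iUnion, true_iff]
    have h1 : ‖(a:ℂ)‖ < 1 := mem_unitDisk.1 a.2.1
    obtain ⟨n, hn⟩ := (tendsto_rad.eventually (lt_mem_nhds h1)).exists
    exact ⟨n, hn.le⟩
  rw [this]
  exact Set.countable_iUnion fun n => (ZS_finite hg hg0 (rad_lt n)).countable

lemma ZI_countable (hg : DifferentiableOn ℂ g unitDisk) (hg0 : g 0 ≠ 0) : Countable (ZI g) := by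
  have := ZS_countable hg hg0
  infer_instance

lemma good_radius (hg : DifferentiableOn ℂ g unitDisk) (hg0 : g 0 ≠ 0) {s : ℝ} (hs : s < 1) :
    ∃ R, s < R ∧ R < 1 ∧ ∀ z, ‖z‖ = R → g z ≠ 0 := by
  set s' := (s + 1) / 2 with hs'
  have hfin := (zeros_finite hg hg0 (s := s') (by linarith)).image norm
  obtain ⟨R, hR, hRn⟩ := ((Set.Ioo_infinite (a := s) (b := s') (by linarith)).sdiff hfin).nonempty
  refine ⟨R, hR.1, by linarith [hR.2], fun z hz h0 => hRn ⟨z, ⟨?_, h0⟩, hz⟩⟩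
  rw [hz]; exact hR.2.le

/-- Factorization of `g` on the closed disk of radius `R`. -/
lemma disc_factor (hg : DifferentiableOn ℂ g unitDisk) (hg0 : g 0 ≠ 0) {R : ℝ} (hR0 : 0 < R)
    (hR1 : R < 1) (hz : ∀ z, ‖z‖ = R → g z ≠ 0) :
    ∃ (s : Finset (ZI g)) (k : ℂ → ℂ), (∀ i, i ∈ s ↔ ‖zf g i‖ < R) ∧
      DiffContOnCl ℂ k (Metric.ball 0 1) ∧
      ∀ z ∈ Metric.closedBall (0:ℂ) 1,
        g (R * z) = (∏ i ∈ s, blaschkeFactor (zf g i / R) z) * Complex.exp (k z) := by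
  classical
  have hRc : (R:ℂ) ≠ 0 := by exact_mod_cast hR0.ne'
  have hfin := ZS_finite hg hg0 hR1
  set T := hfin.toFinset with hT
  have hTm : ∀ a : ZS g, a ∈ T ↔ ‖(a:ℂ)‖ ≤ R := fun a => by simp [hT]
  have hTlt : ∀ a ∈ T, ‖(a:ℂ)‖ < R := fun a ha =>
    lt_of_le_of_ne ((hTm a).1 ha) fun h => hz _ h a.2.2
  have ha0 : ∀ a : ZS g, (a:ℂ) ≠ 0 := fun a h => hg0 (by
    have := a.2.2
    rwa [h] at this)
  obtain ⟨h, hh, hne, hgh⟩ := finite_factor isOpen_unitDisk hg (T.map (Function.Embedding.subtype _))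
    (fun a ha => by
      obtain ⟨b, _, rfl⟩ := Finset.mem_map.1 ha
      exact ⟨b.2.1, order_ne_top hg hg0 b.2.1⟩)
  have hh0 : ∀ z, ‖z‖ ≤ R → h z ≠ 0 := by
    intro z hzR hhz
    have hzd : z ∈ unitDisk := mem_unitDisk.2 (by linarith)
    by_cases hgz : g z = 0
    · refine hne z (Finset.mem_map.2 ⟨⟨z, hzd, hgz⟩, (hTm _).2 hzR, rfl⟩) hhz
    · apply hgz
      rw [hgh z hzd, hhz, mul_zero]
  -- the unit factors
  set c : ZS g → ℂ → ℂ := fun a z =>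
    -(R * (a / (‖(a:ℂ)‖ : ℂ))) * (1 - (starRingEnd ℂ) (a / R : ℂ) * z) with hc
  have haR : ∀ a ∈ T, ‖((a:ℂ) / R)‖ < 1 := fun a ha => by
    rw [norm_div, Complex.norm_real, Real.norm_of_nonneg hR0.le, div_lt_one hR0]
    exact hTlt a ha
  have hnn : ∀ a : ZS g, (‖(a:ℂ)‖ : ℂ) ≠ 0 := fun a => by
    exact_mod_cast (norm_pos_iff.2 (ha0 a)).ne'
  have hcden : ∀ a ∈ T, ∀ z : ℂ, ‖z‖ ≤ 1 → 1 - (starRingEnd ℂ) (a / R : ℂ) * z ≠ 0 := by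
    intro a ha z hz1 h1
    have h2 : (starRingEnd ℂ) (a / R : ℂ) * z = 1 := (sub_eq_zero.1 h1).symm
    have h3 := congrArg norm h2
    rw [norm_mul, RCLike.norm_conj, norm_one] at h3
    have h4 := haR a ha
    have h5 := norm_nonneg z
    have h6 := norm_nonneg ((a:ℂ) / R)
    nlinarith
  have hc0 : ∀ a ∈ T, ∀ z : ℂ, ‖z‖ ≤ 1 → c a z ≠ 0 := by
    intro a ha z hz1
    exact mul_ne_zero (neg_ne_zero.2 (mul_ne_zero hRc (div_ne_zero (ha0 a) (hnn a))))
      (hcden a ha z hz1)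
  have hcb : ∀ a ∈ T, ∀ z : ℂ, ‖z‖ ≤ 1 →
      R * z - a = blaschkeFactor ((a:ℂ) / R) z * c a z := by
    intro a ha z hz1
    have h1 := hcden a ha z hz1
    have h2 := hnn a
    have h3 := ha0 a
    have e : (‖((a:ℂ) / R)‖ : ℂ) = (‖(a:ℂ)‖ : ℂ) / R := by
      rw [norm_div, Complex.norm_real, Real.norm_of_nonneg hR0.le, Complex.ofReal_div]
    simp only [hc, blaschkeFactor]
    rw [e]
    generalize 1 - (starRingEnd ℂ) (a / R : ℂ) * z = D at h1 ⊢
    generalize (‖(a:ℂ)‖ : ℂ) = N at h2 ⊢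
    field_simp
    ring
  set H : ℂ → ℂ := fun z => (∏ a ∈ T, c a z ^ analyticOrderNatAt g a) * h (R * z) with hH
  have hHd : DifferentiableOn ℂ H (Metric.ball 0 (1 / R)) := by
    refine DifferentiableOn.mul ?_ ?_
    · refine DifferentiableOn.fun_finsetProd fun a _ => ?_
      simp only [hc]
      fun_prop
    · refine hh.comp (by fun_prop) fun z hz => ?_
      rw [mem_unitDisk, norm_mul, Complex.norm_real, Real.norm_of_nonneg hR0.le]
      have : ‖z‖ < 1 / R := by simpa using hz
      rwa [lt_div_iff₀ hR0, mul_comm] at this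
  have hH0 : ∀ z ∈ Metric.closedBall (0:ℂ) 1, H z ≠ 0 := by
    intro z hz
    have hz1 : ‖z‖ ≤ 1 := by simpa using hz
    refine mul_ne_zero (Finset.prod_ne_zero_iff.2 fun a ha => pow_ne_zero _ (hc0 a ha z hz1))
      (hh0 _ ?_)
    rw [norm_mul, Complex.norm_real, Real.norm_of_nonneg hR0.le]
    exact mul_le_of_le_one_right hR0.le hz1
  have hopen : IsOpen (Metric.ball (0:ℂ) (1 / R) ∩ H ⁻¹' {0}ᶜ) :=
    hHd.continuousOn.isOpen_inter_preimage Metric.isOpen_ball isOpen_compl_singleton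
  obtain ⟨δ, hδ, hsub⟩ := (isCompact_closedBall (0:ℂ) 1).exists_thickening_subset_open hopen
    (fun z hz => ⟨Metric.closedBall_subset_ball (by rwa [lt_div_iff₀ hR0, one_mul]) hz, hH0 z hz⟩)
  rw [thickening_closedBall hδ zero_le_one] at hsub
  obtain ⟨k, hk, hkH⟩ := exists_holo_log (h := H) (ρ := δ + 1) (by linarith)
    (hHd.mono fun z hz => (hsub hz).1) (fun z hz => (hsub hz).2)
  have hcb1 : Metric.closedBall (0:ℂ) 1 ⊆ Metric.ball 0 (δ + 1) :=
    Metric.closedBall_subset_ball (by linarith)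
  refine ⟨T.sigma fun a => Finset.univ, k, fun i => ?_, ?_, ?_⟩
  · simp only [Finset.mem_sigma, Finset.mem_univ, and_true]
    exact ⟨fun hi => hTlt _ hi, fun hi => (hTm _).2 (le_of_lt hi)⟩
  · refine DifferentiableOn.diffContOnCl ?_
    rw [closure_ball (0:ℂ) one_ne_zero]
    exact hk.mono hcb1
  · intro z hz
    have hz1 : ‖z‖ ≤ 1 := by simpa using hz
    have hRz : (R * z : ℂ) ∈ unitDisk := by
      rw [mem_unitDisk, norm_mul, Complex.norm_real, Real.norm_of_nonneg hR0.le]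
      nlinarith
    rw [hgh _ hRz, ← hkH z (hcb1 hz), Finset.prod_map, Finset.prod_sigma, hH, ← mul_assoc]
    simp only [← Finset.prod_mul_distrib, Function.Embedding.subtype_apply]
    congr 1
    refine Finset.prod_congr rfl fun a ha => ?_
    rw [hcb a ha z hz1, mul_pow]
    simp [zf]

lemma bl_norm_one {a z : ℂ} (ha : ‖a‖ < 1) (ha0 : a ≠ 0) (hz : ‖z‖ = 1) :
    ‖blaschkeFactor a z‖ = 1 := by
  have h1 : ‖a - z‖ = ‖1 - (starRingEnd ℂ) a * z‖ := by
    have : 1 - (starRingEnd ℂ) a * z = z * (starRingEnd ℂ) (z - a) := by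
      rw [map_sub, mul_sub, Complex.mul_conj', hz]
      simp
      ring
    rw [this, norm_mul, hz, one_mul, RCLike.norm_conj, norm_sub_rev]
  have h2 : ‖a - z‖ ≠ 0 := by
    rw [norm_ne_zero_iff, sub_ne_zero]
    rintro rfl
    linarith
  unfold blaschkeFactor
  rw [norm_mul, norm_div, norm_div, Complex.norm_real, norm_norm, ← h1, div_self h2,
    div_self (norm_ne_zero_iff.2 ha0), one_mul]

end


/-- Remove the zero at the origin, and transfer the growth bound. -/
lemma reduce {p : ℝ} (hp : 1 < p) {f : ℂ → ℂ} (hf : f ∈ NpClass p)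
    (hne : ¬ Set.EqOn f 0 unitDisk) :
    ∃ (m : ℕ) (g : ℂ → ℂ), DifferentiableOn ℂ g unitDisk ∧ g 0 ≠ 0 ∧
      (∀ z ∈ unitDisk, f z = z ^ m * g z) ∧
      ∃ K : ℝ≥0∞, K ≠ ∞ ∧ ∀ R : ℝ, 1 / 2 ≤ R → R < 1 → 
        ∫⁻ t, ENNReal.ofReal (max (Real.log ‖g (circlePt R t)‖) 0 + 1) ^ p ∂mC ≤ K := by
  obtain ⟨hfd, hfs⟩ := hf
  have h0 : (0:ℂ) ∈ unitDisk := mem_unitDisk.2 (by simp)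
  have htop : analyticOrderAt f 0 ≠ ⊤ := by
    intro h
    rw [analyticOrderAt_eq_top] at h
    exact hne ((hfd.analyticOnNhd isOpen_unitDisk).eqOn_zero_of_preconnected_of_eventuallyEq_zero
      (convex_ball (0:ℂ) 1).isPreconnected h0 h)
  obtain ⟨g, hg, hgne, hfg⟩ := finite_factor isOpen_unitDisk hfd {0} (by simpa using ⟨h0, htop⟩)
  set m := analyticOrderNatAt f 0 with hm
  have hfg' : ∀ z ∈ unitDisk, f z = z ^ m * g z := by
    intro z hz
    simpa using hfg z hz
  refine ⟨m, g, hg, hgne 0 (by simp), hfg', ?_⟩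
  set A := ⨆ r ∈ Set.Ico (0 : ℝ) 1,
      (∫⁻ θ in Set.Ioc 0 (2 * π),
        ENNReal.ofReal (Real.log ‖f (circlePt r θ)‖) ^ p) / ENNReal.ofReal (2 * π) with hA
  set c := ENNReal.ofReal (m * Real.log 2 + 1) with hc
  refine ⟨2 ^ (p - 1) * (c ^ p + A), ?_, ?_⟩
  · refine ENNReal.mul_ne_top (ENNReal.rpow_ne_top_of_nonneg (by linarith) (by simp)) ?_
    exact ENNReal.add_ne_top.2 ⟨ENNReal.rpow_ne_top_of_nonneg (by linarith) (by simp [hc]), hfs.ne⟩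
  intro R hR hR1
  have hR0 : 0 ≤ R := by linarith
  have hAR : ∫⁻ t, ENNReal.ofReal (Real.log ‖f (circlePt R t)‖) ^ p ∂mC ≤ A := by
    rw [lintegral_mC]
    exact le_iSup₂_of_le (f := fun r (_ : r ∈ Set.Ico (0 : ℝ) 1) =>
      (∫⁻ θ in Set.Ioc 0 (2 * π),
        ENNReal.ofReal (Real.log ‖f (circlePt r θ)‖) ^ p) / ENNReal.ofReal (2 * π))
      R ⟨hR0, hR1⟩ le_rfl
  have hl2 : 0 ≤ Real.log 2 := Real.log_nonneg (by norm_num)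
  have hpt : ∀ t, ENNReal.ofReal (max (Real.log ‖g (circlePt R t)‖) 0 + 1) ^ p ≤
      2 ^ (p - 1) * (c ^ p + ENNReal.ofReal (Real.log ‖f (circlePt R t)‖) ^ p) := by
    intro t
    refine le_trans ?_ (ENNReal.rpow_add_le_mul_rpow_add_rpow _ _ hp.le)
    refine ENNReal.rpow_le_rpow ?_ (by linarith)
    have key : Real.log ‖g (circlePt R t)‖ ≤ m * Real.log 2 + max (Real.log ‖f (circlePt R t)‖) 0 := by
      by_cases hg0 : g (circlePt R t) = 0
      · rw [hg0]; simp; positivity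
      have hgp : 0 < ‖g (circlePt R t)‖ := norm_pos_iff.2 hg0
      have : ‖f (circlePt R t)‖ = R ^ m * ‖g (circlePt R t)‖ := by
        rw [hfg' _ (circlePt_mem hR0 hR1), norm_mul, norm_pow, norm_circlePt hR0]
      have hRp : 0 < R := by linarith
      rw [this, Real.log_mul (by positivity) hgp.ne', Real.log_pow]
      have h1 : - Real.log 2 ≤ Real.log R := by
        rw [← Real.log_inv]
        exact Real.log_le_log (by norm_num) (by linarith)
      have h2 : (m:ℝ) * (-Real.log 2) ≤ m * Real.log R := by gcongr
      have := le_max_left ((m:ℝ) * Real.log R + Real.log ‖g (circlePt R t)‖) 0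
      linarith
    calc ENNReal.ofReal (max (Real.log ‖g (circlePt R t)‖) 0 + 1)
        ≤ ENNReal.ofReal ((m * Real.log 2 + 1) + max (Real.log ‖f (circlePt R t)‖) 0) := by
          refine ENNReal.ofReal_le_ofReal ?_
          have h3 : 0 ≤ (m:ℝ) * Real.log 2 := by positivity
          have h4 := le_max_right (Real.log ‖f (circlePt R t)‖) 0
          have := max_le key (show (0:ℝ) ≤ _ by linarith)
          linarith
      _ = _ := by
          rw [ENNReal.ofReal_add (by positivity) (le_max_right _ _), hc]
          congr 1
          rcases le_total (Real.log ‖f (circlePt R t)‖) 0 with h | h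
          · rw [max_eq_right h, ENNReal.ofReal_of_nonpos h]; simp
          · rw [max_eq_left h]
  calc _ ≤ ∫⁻ t, 2 ^ (p - 1) * (c ^ p + ENNReal.ofReal (Real.log ‖f (circlePt R t)‖) ^ p) ∂mC :=
        lintegral_mono hpt
    _ = 2 ^ (p - 1) * (c ^ p + ∫⁻ t, ENNReal.ofReal (Real.log ‖f (circlePt R t)‖) ^ p ∂mC) := by
        rw [lintegral_const_mul' _ _ (ENNReal.rpow_ne_top_of_nonneg (by linarith) (by simp)),
          lintegral_add_left measurable_const]
        simp
    _ ≤ _ := by gcongr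

lemma bl_at_zero {a : ℂ} (ha0 : a ≠ 0) : ‖blaschkeFactor a 0‖ = ‖a‖ := by
  have : ‖a‖ ≠ 0 := norm_ne_zero_iff.2 ha0
  simp [blaschkeFactor, ha0]

/-- The basic estimates at one radius. -/
lemma radius_est {p : ℝ} (hp : 1 < p) {g : ℂ → ℂ} (hg : DifferentiableOn ℂ g unitDisk)
    (hg0 : g 0 ≠ 0) {R : ℝ} (hR0 : 0 < R) (hR1 : R < 1) (hz : ∀ z, ‖z‖ = R → g z ≠ 0)
    {K : ℝ≥0∞} (hKt : K ≠ ∞)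
    (hbd : ∫⁻ t, ENNReal.ofReal (max (Real.log ‖g (circlePt R t)‖) 0 + 1) ^ p ∂mC ≤ K) :
    ∃ (s : Finset (ZI g)) (k : ℂ → ℂ) (w : ℝ → ℝ), (∀ i, i ∈ s ↔ ‖zf g i‖ < R) ∧
      Continuous w ∧
      (∀ z ∈ unitDisk, k z = (k 0).im * Complex.I + ∫ t, hK z t * (w t : ℂ) ∂mC) ∧
      (∀ z ∈ unitDisk,
        g (R * z) = (∏ i ∈ s, blaschkeFactor (zf g i / R) z) * Complex.exp (k z)) ∧
      ∫⁻ t, ENNReal.ofReal (max (w t) 0 + 1) ^ p ∂mC ≤ K ∧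
      ∫ t, (max (-w t) 0 + 1) ∂mC ≤ K.toReal - Real.log ‖g 0‖ ∧
      ∑ i ∈ s, (1 - ‖zf g i‖ / R) ≤ K.toReal - Real.log ‖g 0‖ := by
  obtain ⟨s, k, hs, hk, hfac⟩ := disc_factor hg hg0 hR0 hR1 hz
  set w : ℝ → ℝ := fun t => (k (Complex.exp (t * Complex.I))).re with hw
  have hn1 : ∀ t : ℝ, ‖Complex.exp (t * Complex.I)‖ = 1 := Complex.norm_exp_ofReal_mul_I
  have hwc : Continuous w := by
    have hc : ContinuousOn k (Metric.closedBall 0 1) := hk.continuousOn_ball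
    exact Complex.continuous_re.comp (hc.comp_continuous (by fun_prop) (fun t => by
      simp [hn1 t]))
  have hna : ∀ i, ‖zf g i / (R:ℂ)‖ = ‖zf g i‖ / R := fun i => by
    rw [norm_div, Complex.norm_real, Real.norm_of_nonneg hR0.le]
  have hRc : (R:ℂ) ≠ 0 := by exact_mod_cast hR0.ne'
  have hane : ∀ i, zf g i / (R:ℂ) ≠ 0 := fun i => div_ne_zero (zf_ne hg0 i) hRc
  have hwl : ∀ t, w t = Real.log ‖g (circlePt R t)‖ := by
    intro t
    rw [circlePt, hfac _ (by simp [hn1 t]), norm_mul, norm_prod, Finset.prod_eq_one, one_mul,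
      Complex.norm_exp, Real.log_exp]
    intro i hi
    refine bl_norm_one ?_ (hane i) (hn1 t)
    rw [hna, div_lt_one hR0]
    exact (hs i).1 hi
  have hbd' : ∫⁻ t, ENNReal.ofReal (max (w t) 0 + 1) ^ p ∂mC ≤ K := by
    simpa only [hwl] using hbd
  have cint : ∀ v : ℝ → ℝ, Continuous v → Integrable v mC := fun v hv =>
    integrable_mC_iff.2 hv.integrableOn_Ioc
  have hpc : Continuous fun t => max (w t) 0 + 1 := by fun_prop
  have hnc : Continuous fun t => max (-w t) 0 + 1 := by fun_prop
  have hpos : ∫ t, (max (w t) 0 + 1) ∂mC ≤ K.toReal := by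
    have h0 : ∀ t, 0 ≤ max (w t) 0 + 1 := fun t => by positivity
    rw [integral_eq_lintegral_of_nonneg_ae (Eventually.of_forall h0) hpc.aestronglyMeasurable]
    refine ENNReal.toReal_mono hKt (le_trans (lintegral_mono fun t => ?_) hbd')
    refine ENNReal.le_rpow_self_of_one_le ?_ hp.le
    rw [← ENNReal.ofReal_one]
    exact ENNReal.ofReal_le_ofReal (by linarith [le_max_right (w t) 0])
  have hsch : ∀ z ∈ unitDisk, k z = (k 0).im * Complex.I + ∫ t, hK z t * (w t : ℂ) ∂mC :=
    fun z hz => schwarz_formula hk hz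
  have h0 : (0:ℂ) ∈ unitDisk := mem_unitDisk.2 (by simp)
  have hk0 : (k 0).re = ∫ t, w t ∂mC := by
    have e1 := congrArg Complex.re (hsch 0 h0)
    have e2 : ∫ t, ((w t:ℝ):ℂ) ∂mC = ((∫ t, w t ∂mC:ℝ):ℂ) := integral_ofReal
    simp only [hK_zero, one_mul, e2] at e1
    simpa using e1
  have hg0' : Real.log ‖g 0‖ = ∑ i ∈ s, Real.log (‖zf g i‖ / R) + (k 0).re := by
    have := hfac 0 (by simp)
    rw [mul_zero] at this
    rw [this, norm_mul, norm_prod, Real.log_mul, Real.log_prod, Complex.norm_exp, Real.log_exp]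
    · congr 1
      refine Finset.sum_congr rfl fun i _ => ?_
      rw [bl_at_zero (hane i), hna]
    · intro i _
      rw [bl_at_zero (hane i)]
      exact norm_ne_zero_iff.2 (hane i)
    · refine Finset.prod_ne_zero_iff.2 fun i _ => ?_
      rw [bl_at_zero (hane i)]
      exact norm_ne_zero_iff.2 (hane i)
    · simp
  have hsum : ∑ i ∈ s, (1 - ‖zf g i‖ / R) ≤ (k 0).re - Real.log ‖g 0‖ := by
    rw [hg0', show (k 0).re - (∑ i ∈ s, Real.log (‖zf g i‖ / R) + (k 0).re) =
      ∑ i ∈ s, (- Real.log (‖zf g i‖ / R)) by rw [Finset.sum_neg_distrib]; ring]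
    refine Finset.sum_le_sum fun i _ => ?_
    have := Real.log_le_sub_one_of_pos (x := ‖zf g i‖ / R)
      (div_pos (norm_pos_iff.2 (zf_ne hg0 i)) hR0)
    linarith
  have hsum0 : 0 ≤ ∑ i ∈ s, (1 - ‖zf g i‖ / R) := by
    refine Finset.sum_nonneg fun i hi => ?_
    have : ‖zf g i‖ / R < 1 := (div_lt_one hR0).2 ((hs i).1 hi)
    linarith
  have hwle : ∫ t, w t ∂mC ≤ K.toReal := by
    refine le_trans (integral_mono (cint _ hwc) (cint _ hpc) fun t => ?_) hpos
    have := le_max_left (w t) 0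
    simp only; linarith
  refine ⟨s, k, w, hs, hwc, hsch, fun z hz => hfac z ?_, hbd', ?_, ?_⟩
  · have := mem_unitDisk.1 hz
    simpa using this.le
  · have e : ∫ t, (max (-w t) 0 + 1) ∂mC = ∫ t, (max (w t) 0 + 1) ∂mC - ∫ t, w t ∂mC := by
      rw [← integral_sub (cint _ hpc) (cint _ hwc)]
      congr 1
      ext t
      rcases le_total (w t) 0 with h | h
      · rw [max_eq_left (by linarith), max_eq_right h]; ring
      · rw [max_eq_right (by linarith), max_eq_left h]; ring
    rw [e]
    linarith
  · linarith


lemma bl_limit {ι : Type*} {a : ι → ℂ} (h : BlData a) {R : ℕ → ℝ} (hR0 : ∀ n, 0 < R n)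
    (hR1 : ∀ n, R n < 1) (hR : Tendsto R atTop (𝓝 1)) {s : ℕ → Finset ι}
    (hs : ∀ n i, i ∈ s n ↔ ‖a i‖ < R n) {z : ℂ} (hz : z ∈ unitDisk) :
    Tendsto (fun n => ∏ i ∈ s n, blaschkeFactor (a i / R n) z) atTop (𝓝 (blP a z)) := by
  classical
  have hz1 := mem_unitDisk.1 hz
  set F : ℕ → ι → ℂ := fun n i => if i ∈ s n then blaschkeFactor (a i / R n) z - 1 else 0 with hF
  have e1 : ∀ n, ∏ i ∈ s n, blaschkeFactor (a i / R n) z = ∏' i, (1 + F n i) := by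
    intro n
    rw [tprod_eq_prod (s := s n)]
    · refine Finset.prod_congr rfl fun i hi => ?_
      simp [hF, hi]
    · intro i hi
      simp [hF, hi]
  have e2 : blP a z = ∏' i, (1 + (blaschkeFactor (a i) z - 1)) := by
    simp [blP]
  simp_rw [e1]
  rw [e2]
  refine tendsto_tprod_one_add_of_dominated_convergence
    (bound := fun i => (1 - ‖a i‖) * (2 / (1 - ‖z‖))) (h.2.mul_right _) ?_ ?_
  · intro i
    have hai : ‖a i‖ < 1 := mem_unitDisk.1 (h.1 i).1
    have hev : ∀ᶠ n in atTop, i ∈ s n := by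
      filter_upwards [hR.eventually (lt_mem_nhds hai)] with n hn
      exact (hs n i).2 hn
    have hlim : Tendsto (fun n => blaschkeFactor (a i / R n) z - 1) atTop
        (𝓝 (blaschkeFactor (a i) z - 1)) := by
      have hc : ContinuousAt (fun b : ℂ => blaschkeFactor b z) (a i) := by
        unfold blaschkeFactor
        refine ContinuousAt.mul ?_ ?_
        · exact ContinuousAt.div (by fun_prop) continuousAt_id (h.1 i).2
        · refine ContinuousAt.div (by fun_prop) ?_ (bl_den_ne_zero hai.le hz)
          have : Continuous fun b : ℂ => 1 - (starRingEnd ℂ) b * z := by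
            have := Complex.continuous_conj
            fun_prop
          exact this.continuousAt
      have ht : Tendsto (fun n => a i / (R n : ℂ)) atTop (𝓝 (a i)) := by
        have : Tendsto (fun n => ((R n : ℝ) : ℂ)) atTop (𝓝 ((1:ℝ):ℂ)) :=
          (Complex.continuous_ofReal.tendsto 1).comp hR
        have h2 := (tendsto_const_nhds (x := a i)).div this (by simp)
        rw [Complex.ofReal_one, div_one] at h2
        exact h2
      exact (hc.tendsto.comp ht).sub_const 1
    refine hlim.congr' ?_
    filter_upwards [hev] with n hn
    simp [hF, hn]
  · refine Eventually.of_forall fun n i => ?_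
    have hai : ‖a i‖ < 1 := mem_unitDisk.1 (h.1 i).1
    have hna : ‖a i / (R n:ℂ)‖ = ‖a i‖ / R n := by
      rw [norm_div, Complex.norm_real, Real.norm_of_nonneg (hR0 n).le]
    have hRc : (R n:ℂ) ≠ 0 := by exact_mod_cast (hR0 n).ne'
    have hpos : 0 ≤ 2 / (1 - ‖z‖) := div_nonneg (by norm_num) (by linarith)
    by_cases hi : i ∈ s n
    · simp only [hF, hi, if_true]
      refine (bl_sub_one_le ?_ (div_ne_zero (h.1 i).2 hRc) hz).trans ?_
      · rw [hna, div_le_one (hR0 n)]; exact ((hs n i).1 hi).le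
      · refine mul_le_mul_of_nonneg_right ?_ hpos
        rw [hna]
        have : ‖a i‖ ≤ ‖a i‖ / R n := le_div_self (norm_nonneg _) (hR0 n) (hR1 n).le
        linarith
    · simp only [hF, hi, if_false, norm_zero]
      exact mul_nonneg (by linarith) hpos

/-- Factorization of `g` before decomposing the limit measure. -/
lemma g_factor {p : ℝ} (hp : 1 < p) {g : ℂ → ℂ} (hg : DifferentiableOn ℂ g unitDisk)
    (hg0 : g 0 ≠ 0) {K : ℝ≥0∞} (hKt : K ≠ ∞)
    (hbd : ∀ R : ℝ, 1 / 2 ≤ R → R < 1 →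
      ∫⁻ t, ENNReal.ofReal (max (Real.log ‖g (circlePt R t)‖) 0 + 1) ^ p ∂mC ≤ K) :
    BlData (zf g) ∧ ∃ (Φ : ℝ → ℝ) (ν : Measure ℝ) (ω : ℂ), Integrable Φ mC ∧ (∀ t, 0 ≤ Φ t) ∧
      Measurable Φ ∧
      ∫⁻ t, ENNReal.ofReal (Φ t) ^ p ∂mC < ∞ ∧ IsFiniteMeasure ν ∧
      ν (Set.Icc 0 (2 * π))ᶜ = 0 ∧ ‖ω‖ = 1 ∧
      ∀ z ∈ unitDisk, g z = blP (zf g) z * (ω * outerFn Φ z * singFn ν z) := by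
  have hgr : ∀ n, ∃ R, max (1 / 2) (rad n) < R ∧ R < 1 ∧ ∀ z, ‖z‖ = R → g z ≠ 0 := fun n =>
    good_radius hg hg0 (max_lt (by norm_num) (rad_lt n))
  choose R hRl hR1 hRz using hgr
  have hRh : ∀ n, 1 / 2 ≤ R n := fun n => (le_max_left _ _).trans (hRl n).le
  have hR0 : ∀ n, 0 < R n := fun n => by linarith [hRh n]
  have hRt : Tendsto R atTop (𝓝 1) :=
    tendsto_of_tendsto_of_tendsto_of_le_of_le tendsto_rad tendsto_const_nhds
      (fun n => (le_max_right _ _).trans (hRl n).le) (fun n => (hR1 n).le)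
  have hest := fun n => radius_est hp hg hg0 (hR0 n) (hR1 n) (hRz n) hKt
    (hbd (R n) (hRh n) (hR1 n))
  choose s k w hs hwc hk hfac hpos hneg hsum using hest
  set C := K.toReal - Real.log ‖g 0‖ with hC
  have hBl : BlData (zf g) := by
    refine ⟨fun i => ⟨zf_mem i, zf_ne hg0 i⟩, ?_⟩
    refine summable_of_sum_le (c := C) (fun i => ?_) fun u => ?_
    · have := mem_unitDisk.1 (zf_mem i); simp only [Pi.zero_apply]; linarith
    · have hl : Tendsto (fun n => ∑ i ∈ u, (1 - ‖zf g i‖ / R n)) atTop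
          (𝓝 (∑ i ∈ u, (1 - ‖zf g i‖))) := by
        refine tendsto_finsetSum _ fun i _ => ?_
        have := (tendsto_const_nhds (x := ‖zf g i‖)).div hRt one_ne_zero
        simpa using this.const_sub 1
      have hev : ∀ᶠ n in atTop, ∀ i ∈ u, i ∈ s n := by
        rw [Filter.eventually_all_finset]
        intro i _
        filter_upwards [hRt.eventually (lt_mem_nhds (mem_unitDisk.1 (zf_mem i)))] with n hn
        exact (hs n i).2 hn
      refine le_of_tendsto hl ?_
      filter_upwards [hev] with n hn
      refine le_trans (Finset.sum_le_sum_of_subset_of_nonneg hn fun i hi _ => ?_) (hsum n)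
      have : ‖zf g i‖ / R n < 1 := (div_lt_one (hR0 n)).2 ((hs n i).1 hi)
      linarith
  refine ⟨hBl, ?_⟩
  have cint : ∀ v : ℝ → ℝ, Continuous v → Integrable v mC := fun v hv =>
    integrable_mC_iff.2 hv.integrableOn_Ioc
  have hpc : ∀ n, Continuous fun t => max (w n t) 0 + 1 := fun n => by
    have := hwc n; fun_prop
  have hnc : ∀ n, Continuous fun t => max (-w n t) 0 + 1 := fun n => by
    have := hwc n; fun_prop
  obtain ⟨Φ, hΦm, hΦ0, hΦi, hΦp, σ, hσ, hΦl⟩ := weak_Lp hp (fun n t => max (w n t) 0 + 1)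
    (fun n => (hpc n).measurable) (fun n t => by linarith [le_max_right (w n t) 0])
    (fun n => cint _ (hpc n)) hKt hpos
  set N : ℕ → Measure ℝ := fun n =>
    mC.withDensity fun t => ENNReal.ofReal (max (-w (σ n) t) 0 + 1) with hN
  have hNu : ∀ n, N n univ = ENNReal.ofReal (∫ t, (max (-w (σ n) t) 0 + 1) ∂mC) := by
    intro n
    rw [hN, withDensity_apply _ MeasurableSet.univ, Measure.restrict_univ,
      ofReal_integral_eq_lintegral_ofReal (cint _ (hnc _))
        (Eventually.of_forall fun t => by positivity)]
  obtain ⟨ν, hνf, hνs, φ, hφ, hνl, -⟩ := weak_compact N C.toNNReal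
    (fun n => by
      rw [hN, withDensity_apply _ MeasurableSet.univ, Measure.restrict_univ]
      calc (1:ℝ≥0∞) = ∫⁻ _, 1 ∂mC := by simp
        _ ≤ _ := lintegral_mono fun t => by
          rw [← ENNReal.ofReal_one]
          exact ENNReal.ofReal_le_ofReal (by linarith [le_max_right (-w (σ n) t) 0]))
    (fun n => by
      rw [hNu]
      exact ENNReal.ofReal_le_ofReal (hneg _))
    (fun n => withDensity_absolutelyContinuous _ _ mC_compl_Icc)
  have hcpt : IsCompact (Metric.sphere (0:ℂ) 1) := isCompact_sphere 0 1
  obtain ⟨ω, hω, τ, hτ, hωl⟩ := hcpt.tendsto_subseq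
    (x := fun n => Complex.exp (((k (σ (φ n)) 0).im : ℂ) * Complex.I))
    (fun n => by simp [Complex.norm_exp_ofReal_mul_I])
  refine ⟨Φ, ν, ω, hΦi, hΦ0, hΦm, lt_of_le_of_lt hΦp hKt.lt_top, hνf, hνs, by simpa using hω, ?_⟩
  intro z hz
  have hφt := (hφ.comp hτ).tendsto_atTop
  have hall := hσ.tendsto_atTop.comp hφt
  have l1 : Tendsto (fun n => g (R (σ (φ (τ n))) * z)) atTop (𝓝 (g z)) := by
    have hgc : ContinuousAt g z := (hg.differentiableAt (isOpen_unitDisk.mem_nhds hz)).continuousAt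
    have h1 : Tendsto (fun n => ((R n : ℝ) : ℂ) * z) atTop (𝓝 z) := by
      have : Tendsto (fun n => ((R n : ℝ) : ℂ)) atTop (𝓝 ((1:ℝ):ℂ)) :=
        (Complex.continuous_ofReal.tendsto 1).comp hRt
      simpa using this.mul_const z
    exact (hgc.tendsto.comp h1).comp hall
  have l2 := (bl_limit hBl hR0 hR1 hRt hs hz).comp hall
  have l3 : Tendsto (fun n => Complex.exp (k (σ (φ (τ n))) z)) atTop
      (𝓝 (ω * outerFn Φ z * singFn ν z)) := by
    have a1 := (hΦl z hz).comp hφt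
    have a2 := (hνl (_root_.hKb hz)).comp hτ.tendsto_atTop
    have e : ∀ n, Complex.exp (k (σ (φ (τ n))) z) =
        Complex.exp (((k (σ (φ (τ n))) 0).im : ℂ) * Complex.I) *
        Complex.exp (∫ t, hK z t * ((max (w (σ (φ (τ n))) t) 0 + 1 : ℝ) : ℂ) ∂mC) *
        Complex.exp (-∫ t, _root_.hKb hz t ∂(N (φ (τ n)))) := by
      intro n
      rw [hk _ z hz, mul_assoc, ← Complex.exp_add, ← Complex.exp_add, hN]
      congr 2
      have := integral_withDensity_hK (hnc (σ (φ (τ n)))).measurable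
        (fun t => by positivity) (_root_.hKb hz)
      rw [this]
      have i1 : Integrable (fun t => hK z t * ((max (w (σ (φ (τ n))) t) 0 + 1 : ℝ) : ℂ)) mC :=
        integrable_hK (cint _ (hpc _)).ofReal hz
      have i2 : Integrable (fun t => hK z t * ((max (-w (σ (φ (τ n))) t) 0 + 1 : ℝ) : ℂ)) mC :=
        integrable_hK (cint _ (hnc _)).ofReal hz
      rw [← sub_eq_add_neg]
      refine Eq.trans ?_ (integral_sub i1 i2)
      congr 1
      ext t
      rw [show _root_.hKb hz t = hK z t from rfl, ← mul_sub, ← Complex.ofReal_sub]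
      congr 2
      rcases le_total (w (σ (φ (τ n))) t) 0 with h | h
      · rw [max_eq_right h, max_eq_left (neg_nonneg.2 h)]; ring
      · rw [max_eq_left h, max_eq_right (neg_nonpos.2 h)]; ring
    simp_rw [e]
    refine (hωl.mul ?_).mul ?_
    · exact (Complex.continuous_exp.tendsto _).comp a1
    · exact (Complex.continuous_exp.tendsto _).comp a2.neg
  refine tendsto_nhds_unique l1 ?_
  refine (l2.mul l3).congr fun n => ?_
  exact (hfac _ z hz).symm


/-- Move the mass at `0` to `2π`. -/
lemma push_Ioc (ν : Measure ℝ) [IsFiniteMeasure ν] (hν : ν (Set.Icc 0 (2 * π))ᶜ = 0) :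
    ∃ ν' : Measure ℝ, IsFiniteMeasure ν' ∧ ν' (Set.Ioc 0 (2 * π))ᶜ = 0 ∧
      ∀ z, ∫ t, hK z t ∂ν' = ∫ t, hK z t ∂ν := by
  set T : ℝ → ℝ := fun t => if t = 0 then 2 * π else t with hT
  have hTm : Measurable T :=
    Measurable.ite (measurableSet_singleton 0) measurable_const measurable_id
  refine ⟨ν.map T, Measure.isFiniteMeasure_map ν T, ?_, ?_⟩
  · rw [Measure.map_apply hTm measurableSet_Ioc.compl]
    refine measure_mono_null ?_ hν
    intro t ht htc
    apply ht
    simp only [hT]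
    split_ifs with h
    · exact ⟨by positivity, le_rfl⟩
    · exact ⟨lt_of_le_of_ne htc.1 (Ne.symm h), htc.2⟩
  · intro z
    have hm : Measurable (hK z) := by
      unfold hK
      exact Measurable.div (by fun_prop) (by fun_prop)
    rw [integral_map hTm.aemeasurable hm.aestronglyMeasurable]
    congr 1
    ext t
    simp only [hT]
    split_ifs with h
    · subst h
      simp only [hK]
      rw [show Complex.exp (((2 * π : ℝ) : ℂ) * Complex.I) = 1 by
        push_cast; exact Complex.exp_two_pi_mul_I]
      simp
    · rfl

lemma mutSing_iff {μ : Measure ℝ} (h : μ ⟂ₘ mC) (hs : μ (Set.Ioc 0 (2 * π))ᶜ = 0) :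
    μ ⟂ₘ (volume : Measure ℝ) := by
  obtain ⟨s, hsm, h1, h2⟩ := h
  refine ⟨s ∪ (Set.Ioc 0 (2 * π))ᶜ, hsm.union measurableSet_Ioc.compl,
    measure_union_null h1 hs, ?_⟩
  rw [mC, Measure.smul_apply, smul_eq_mul, mul_eq_zero, Measure.restrict_apply hsm.compl] at h2
  rw [Set.compl_union, compl_compl]
  refine h2.resolve_left ?_
  simp only [ne_eq, ENNReal.ofReal_eq_zero, not_le]
  positivity

lemma mutSing_mC {μ : Measure ℝ} (h : μ ⟂ₘ (volume : Measure ℝ)) : μ ⟂ₘ mC := by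
  refine h.mono_ac Measure.AbsolutelyContinuous.rfl ?_
  exact (Measure.absolutelyContinuous_of_le_smul (c := ENNReal.ofReal (1 / (2 * π)))
    (by rw [mC]; gcongr; exact Measure.restrict_le_self))

/-- Lebesgue decomposition of the kernel integral. -/
lemma lebesgue_split (ν : Measure ℝ) [IsFiniteMeasure ν] (hν : ν (Set.Ioc 0 (2 * π))ᶜ = 0) :
    ∃ (μ : Measure ℝ) (d : ℝ → ℝ), IsFiniteMeasure μ ∧ μ ⟂ₘ (volume : Measure ℝ) ∧
      μ (Set.Ioc 0 (2 * π))ᶜ = 0 ∧ Measurable d ∧ (∀ t, 0 ≤ d t) ∧ Integrable d mC ∧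
      ∀ z ∈ unitDisk, ∫ t, hK z t ∂ν = ∫ t, hK z t ∂μ + ∫ t, hK z t * (d t : ℂ) ∂mC := by
  have hs : ν.singularPart mC (Set.Ioc 0 (2 * π))ᶜ = 0 :=
    le_antisymm ((Measure.singularPart_le ν mC _).trans hν.le) (zero_le)
  have hdm : Measurable fun t => (ν.rnDeriv mC t).toReal :=
    (Measure.measurable_rnDeriv ν mC).ennreal_toReal
  refine ⟨ν.singularPart mC, fun t => (ν.rnDeriv mC t).toReal, inferInstance,
    mutSing_iff (Measure.mutuallySingular_singularPart ν mC) hs, hs, hdm,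
    fun t => ENNReal.toReal_nonneg, Measure.integrable_toReal_rnDeriv, ?_⟩
  intro z hz
  have e : mC.withDensity (ν.rnDeriv mC) =
      mC.withDensity fun t => ENNReal.ofReal (ν.rnDeriv mC t).toReal := by
    refine withDensity_congr_ae ?_
    filter_upwards [Measure.rnDeriv_lt_top ν mC] with t ht
    rw [ENNReal.ofReal_toReal ht.ne]
  rw [← integral_withDensity_hK hdm (fun t => ENNReal.toReal_nonneg), ← e,
    ← integral_add_measure]
  · rw [← Measure.haveLebesgueDecomposition_add ν mC]
  · exact integrable_hK_one _ hz
  · exact integrable_hK_one _ hz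

/-- Existence of the factorization. -/
lemma exists_fact {p : ℝ} (hp : 1 < p) {f : ℂ → ℂ} (hf : f ∈ NpClass p)
    (hne : ¬ Set.EqOn f 0 unitDisk) :
    ∃ B S F : ℂ → ℂ, IsBlaschkeProduct B ∧ IsSingularInner S ∧ IsOuter F ∧
      LogPlusBoundaryLp p F ∧ ∀ z ∈ unitDisk, f z = B z * S z * F z := by
  obtain ⟨m, g, hg, hg0, hfg, K, hKt, hbd⟩ := reduce hp hf hne
  obtain ⟨hBl, Φ, ν, ω, hΦi, hΦ0, hΦm, hΦp, hνf, hνs, hω, hgf⟩ := g_factor hp hg hg0 hKt hbd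
  obtain ⟨ν', hν'f, hν's, hν'⟩ := push_Ioc ν hνs
  obtain ⟨μ, d, hμf, hμsing, hμs, hdm, hd0, hdi, hd⟩ := lebesgue_split ν' hν's
  haveI := ZI_countable hg hg0
  have hui : Integrable (fun t => Φ t - d t) mC := hΦi.sub hdi
  refine ⟨fun z => z ^ m * blP (zf g) z, singFn μ, fun z => ω * outerFn (fun t => Φ t - d t) z,
    isBlaschke_of m hBl (fun z _ => rfl), ⟨μ, hμf, hμsing, hμs, fun z _ => rfl⟩,
    isOuter_outerFn hui hω, ?_, ?_⟩
  · rw [LogPlusBoundaryLp, ← lintegral_mC_lt_top]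
    refine lt_of_le_of_lt (lintegral_mono_ae ?_) hΦp
    filter_upwards [log_radialLimit hui hω] with t ht
    rw [ht]
    refine ENNReal.rpow_le_rpow (ENNReal.ofReal_le_ofReal ?_) (by linarith)
    linarith [hd0 t]
  · intro z hz
    rw [hfg z hz, hgf z hz]
    have e : outerFn Φ z * singFn ν z = outerFn (fun t => Φ t - d t) z * singFn μ z := by
      rw [outerFn, singFn, outerFn, singFn, ← Complex.exp_add, ← Complex.exp_add, ← hν', hd z hz]
      congr 1
      have i1 : Integrable (fun t => hK z t * (Φ t : ℂ)) mC := integrable_hK hΦi.ofReal hz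
      have i2 : Integrable (fun t => hK z t * (d t : ℂ)) mC := integrable_hK hdi.ofReal hz
      have : ∫ t, hK z t * ((Φ t - d t : ℝ) : ℂ) ∂mC =
          ∫ t, hK z t * (Φ t : ℂ) ∂mC - ∫ t, hK z t * (d t : ℂ) ∂mC := by
        rw [← integral_sub i1 i2]
        congr 1
        ext t
        push_cast
        ring
      rw [this]
      ring
    rw [mul_assoc ω, e]
    ring


lemma fourier_moment (α : Measure ℝ) [IsFiniteMeasure α] (k : ℕ) :
    ∫ θ, (Complex.exp (θ * Complex.I)) ^ k * ((∫ t, pK (circlePt (1 / 2) θ) t ∂α : ℝ) : ℂ) ∂mC =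
      (1 / 2) ^ k * ∫ t, (Complex.exp (t * Complex.I)) ^ k ∂α := by
  have hr : (0:ℝ) ≤ 1 / 2 := by norm_num
  have hr1 : (1 / 2 : ℝ) < 1 := by norm_num
  have hcont := continuous_pK_prod hr hr1
  have e1 : ∀ θ : ℝ, (Complex.exp (θ * Complex.I)) ^ k *
      ((∫ t, pK (circlePt (1 / 2) θ) t ∂α : ℝ) : ℂ) =
      ∫ t, (Complex.exp (θ * Complex.I)) ^ k * (pK (circlePt (1 / 2) θ) t : ℂ) ∂α := by
    intro θ
    rw [integral_const_mul]
    congr 1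
    exact integral_ofReal.symm
  simp_rw [e1]
  rw [integral_integral_swap]
  · rw [← integral_const_mul]
    congr 1
    ext t
    have h := poisson_formula (f := fun z => z ^ k)
      (differentiable_pow k).diffContOnCl (circlePt_mem hr hr1 (θ := t))
    have e2 : ∀ θ : ℝ, (Complex.exp (θ * Complex.I)) ^ k * (pK (circlePt (1 / 2) θ) t : ℂ) =
        (pK (circlePt (1 / 2) t) θ : ℂ) * (Complex.exp (θ * Complex.I)) ^ k := by
      intro θ
      rw [pK_symm hr, mul_comm]
    simp_rw [e2]
    rw [h, circlePt, mul_pow]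
    push_cast
    rfl
  · have hc : Continuous fun q : ℝ × ℝ =>
        (Complex.exp (q.1 * Complex.I)) ^ k * (pK (circlePt (1 / 2) q.1) q.2 : ℂ) := by
      refine Continuous.mul (by fun_prop) (Complex.continuous_ofReal.comp hcont)
    refine Integrable.of_bound (C := 4) hc.aestronglyMeasurable
      (Eventually.of_forall fun q => ?_)
    simp only [Function.uncurry]
    rw [norm_mul, norm_pow, Complex.norm_exp_ofReal_mul_I, one_pow, one_mul, Complex.norm_real,
      Real.norm_of_nonneg (pK_pos (circlePt_mem hr hr1) _).le]
    refine (pK_le (circlePt_mem hr hr1) _).trans ?_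
    rw [norm_circlePt hr]
    norm_num

instance fact_two_pi : Fact (0 < 2 * π) := ⟨by positivity⟩

lemma pull_back (α : Measure ℝ) (hα : α (Set.Ioc 0 (2 * π))ᶜ = 0) :
    (α.map (fun t : ℝ => (t : AddCircle (2 * π)))).map
      (fun x => ((AddCircle.measurableEquivIoc (2 * π) 0 x : Set.Ioc 0 (0 + 2 * π)) : ℝ)) = α := by
  rw [Measure.map_map]
  · have : ((fun x => ((AddCircle.measurableEquivIoc (2 * π) 0 x : Set.Ioc 0 (0 + 2 * π)) : ℝ)) ∘
        fun t : ℝ => (t : AddCircle (2 * π))) =ᵐ[α] id := by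
      have h : ∀ᵐ t ∂α, t ∈ Set.Ioc 0 (2 * π) := by
        rw [ae_iff]; exact hα
      filter_upwards [h] with t ht
      exact AddCircle.equivIoc_coe_of_mem (p := 2 * π) (a := 0) (by simpa using ht)
    rw [Measure.map_congr this, Measure.map_id]
  · exact measurable_subtype_coe.comp (AddCircle.measurableEquivIoc (2 * π) 0).measurable
  · exact AddCircle.measurable_mk'

/-- A finite measure on the circle is determined by its Poisson integral. -/
lemma measure_unique (α β : Measure ℝ) [IsFiniteMeasure α] [IsFiniteMeasure β]
    (hα : α (Set.Ioc 0 (2 * π))ᶜ = 0) (hβ : β (Set.Ioc 0 (2 * π))ᶜ = 0)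
    (h : ∀ z ∈ unitDisk, ∫ t, pK z t ∂α = ∫ t, pK z t ∂β) : α = β := by
  have hmom : ∀ k : ℕ, ∫ t : ℝ, (Complex.exp (t * Complex.I)) ^ k ∂α =
      ∫ t : ℝ, (Complex.exp (t * Complex.I)) ^ k ∂β := by
    intro k
    have h1 := fourier_moment α k
    have h2 := fourier_moment β k
    have e : ∀ θ : ℝ, ∫ t, pK (circlePt (1 / 2) θ) t ∂α = ∫ t, pK (circlePt (1 / 2) θ) t ∂β :=
      fun θ => h _ (circlePt_mem (by norm_num) (by norm_num))
    simp_rw [e] at h1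
    rw [h1] at h2
    exact mul_left_cancel₀ (pow_ne_zero _ (by norm_num)) h2
  have hmk : Measurable (fun t : ℝ => (t : AddCircle (2 * π))) := AddCircle.measurable_mk'
  set α' := α.map (fun t : ℝ => (t : AddCircle (2 * π))) with hα'
  set β' := β.map (fun t : ℝ => (t : AddCircle (2 * π))) with hβ'
  have : IsFiniteMeasure α' := Measure.isFiniteMeasure_map α _
  have : IsFiniteMeasure β' := Measure.isFiniteMeasure_map β _
  have hfn : ∀ (k : ℕ) (t : ℝ), fourier (T := 2 * π) (k : ℤ) (t : AddCircle (2 * π)) =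
      (Complex.exp (t * Complex.I)) ^ k := by
    intro k t
    rw [fourier_coe_apply, ← Complex.exp_nat_mul]
    congr 1
    have : (π : ℂ) ≠ 0 := by exact_mod_cast Real.pi_ne_zero
    push_cast
    field_simp
  have hfk : ∀ k : ℕ, ∫ x, fourier (T := 2 * π) (k : ℤ) x ∂α' =
      ∫ x, fourier (T := 2 * π) (k : ℤ) x ∂β' := by
    intro k
    rw [hα', hβ', integral_map hmk.aemeasurable
      (ContinuousMap.continuous _).aestronglyMeasurable, integral_map hmk.aemeasurable
      (ContinuousMap.continuous _).aestronglyMeasurable]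
    simp_rw [hfn]
    exact hmom k
  have hf : ∀ n : ℤ, ∫ x, fourier (T := 2 * π) n x ∂α' = ∫ x, fourier (T := 2 * π) n x ∂β' := by
    intro n
    obtain ⟨k, rfl | rfl⟩ := n.eq_nat_or_neg
    · exact hfk k
    · simp_rw [fourier_neg]
      rw [integral_conj, integral_conj, hfk k]
  have hcl : ∀ (γ : Measure (AddCircle (2 * π))) [IsFiniteMeasure γ],
      Continuous fun g : C(AddCircle (2 * π), ℂ) => ∫ x, g x ∂γ := by
    intro γ _
    have : ∀ g : C(AddCircle (2 * π), ℂ), ∫ x, g x ∂γ =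
        ∫ x, (ContinuousMap.toLp (E := ℂ) 1 γ ℂ g) x ∂γ := fun g =>
      integral_congr_ae (ContinuousMap.coeFn_toLp γ g).symm
    simp_rw [this]
    exact continuous_integral.comp (ContinuousMap.toLp (E := ℂ) 1 γ ℂ).continuous
  have hintg : ∀ (γ : Measure (AddCircle (2 * π))) [IsFiniteMeasure γ]
      (g : C(AddCircle (2 * π), ℂ)), Integrable g γ := by
    intro γ _ g
    exact (BoundedContinuousFunction.mkOfCompact g).integrable γ
  have hall : ∀ g : C(AddCircle (2 * π), ℂ), ∫ x, g x ∂α' = ∫ x, g x ∂β' := by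
    intro g
    have hg : g ∈ (Submodule.span ℂ (Set.range <| @fourier (2 * π))).topologicalClosure := by
      rw [span_fourier_closure_eq_top]; trivial
    have hclosed : IsClosed {g : C(AddCircle (2 * π), ℂ) | ∫ x, g x ∂α' = ∫ x, g x ∂β'} :=
      isClosed_eq (hcl α') (hcl β')
    have hsub : (Submodule.span ℂ (Set.range <| @fourier (2 * π)) : Set C(AddCircle (2 * π), ℂ)) ⊆
        {g : C(AddCircle (2 * π), ℂ) | ∫ x, g x ∂α' = ∫ x, g x ∂β'} := by
      intro g hg
      change ∫ x, g x ∂α' = ∫ x, g x ∂β'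
      induction hg using Submodule.span_induction with
      | mem x hx => obtain ⟨n, rfl⟩ := hx; exact hf n
      | zero => simp
      | add x y _ _ hx hy =>
        simp only [ContinuousMap.add_apply]
        rw [integral_add (hintg _ x) (hintg _ y), integral_add (hintg _ x) (hintg _ y), hx, hy]
      | smul c x _ hx =>
        simp only [ContinuousMap.smul_apply]
        rw [integral_smul, integral_smul, hx]
    exact hclosed.closure_subset_iff.2 hsub hg
  have hEq : α' = β' := by
    refine ext_of_forall_integral_eq_of_IsFiniteMeasure fun g => ?_
    have h1 := hall ⟨fun x => (g x : ℂ), Complex.continuous_ofReal.comp g.continuous⟩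
    have e1 : ∫ x, ((g x : ℝ) : ℂ) ∂α' = ((∫ x, g x ∂α' : ℝ) : ℂ) := integral_ofReal
    have e2 : ∫ x, ((g x : ℝ) : ℂ) ∂β' = ((∫ x, g x ∂β' : ℝ) : ℂ) := integral_ofReal
    simp only [ContinuousMap.coe_mk] at h1
    rw [e1, e2] at h1
    exact_mod_cast h1
  rw [← pull_back α hα, ← pull_back β hβ, ← hα', ← hβ', hEq]


lemma sf_measure_unique {μ μ' : Measure ℝ} [IsFiniteMeasure μ] [IsFiniteMeasure μ']
    (hμ : μ ⟂ₘ (volume : Measure ℝ)) (hμ' : μ' ⟂ₘ (volume : Measure ℝ))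
    (hs : μ (Set.Ioc 0 (2 * π))ᶜ = 0) (hs' : μ' (Set.Ioc 0 (2 * π))ᶜ = 0)
    {u u' : ℝ → ℝ} (hu : Integrable u mC) (hu' : Integrable u' mC)
    (hum : Measurable u) (hum' : Measurable u')
    (h : ∀ z ∈ unitDisk, ‖singFn μ z‖ * ‖outerFn u z‖ = ‖singFn μ' z‖ * ‖outerFn u' z‖) :
    μ = μ' := by
  set v : ℝ → ℝ := fun t => max (u t) 0 + max (-u' t) 0 with hv
  set v' : ℝ → ℝ := fun t => max (u' t) 0 + max (-u t) 0 with hv'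
  have hvi : Integrable v mC := hu.pos_part.add hu'.neg_part
  have hvi' : Integrable v' mC := hu'.pos_part.add hu.neg_part
  have hvm : Measurable v := (hum.max measurable_const).add (hum'.neg.max measurable_const)
  have hvm' : Measurable v' := (hum'.max measurable_const).add (hum.neg.max measurable_const)
  have hv0 : ∀ t, 0 ≤ v t := fun t => by positivity
  have hv0' : ∀ t, 0 ≤ v' t := fun t => by positivity
  have fin : ∀ q : ℝ → ℝ, Integrable q mC →
      IsFiniteMeasure (mC.withDensity fun t => ENNReal.ofReal (q t)) := fun q hq =>
    isFiniteMeasure_withDensity_ofReal hq.2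
  have := fin v hvi
  have := fin v' hvi'
  have sup : ∀ q : ℝ → ℝ, (mC.withDensity fun t => ENNReal.ofReal (q t))
      (Set.Ioc 0 (2 * π))ᶜ = 0 := fun q =>
    withDensity_absolutelyContinuous _ _ mC_compl_Ioc
  have dens : ∀ q : ℝ → ℝ, Measurable q → (∀ t, 0 ≤ q t) → ∀ z,
      ∫ t, pK z t ∂(mC.withDensity fun t => ENNReal.ofReal (q t)) = ∫ t, pK z t * q t ∂mC := by
    intro q hq hq0 z
    rw [integral_withDensity_eq_integral_toReal_smul hq.ennreal_ofReal
      (Eventually.of_forall fun t => ENNReal.ofReal_lt_top)]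
    congr 1
    ext t
    rw [ENNReal.toReal_ofReal (hq0 t), smul_eq_mul, mul_comm]
  have key : μ' + mC.withDensity (fun t => ENNReal.ofReal (v t)) =
      μ + mC.withDensity (fun t => ENNReal.ofReal (v' t)) := by
    refine measure_unique _ _ ?_ ?_ ?_
    · rw [Measure.add_apply, hs', sup, add_zero]
    · rw [Measure.add_apply, hs, sup, add_zero]
    · intro z hz
      rw [integral_add_measure (integrable_pK_one _ hz) (integrable_pK_one _ hz),
        integral_add_measure (integrable_pK_one _ hz) (integrable_pK_one _ hz),
        dens v hvm hv0, dens v' hvm' hv0']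
      have hz1 := h z hz
      rw [norm_singFn μ hz, norm_singFn μ' hz, norm_outerFn hu hz, norm_outerFn hu' hz,
        ← Real.exp_add, ← Real.exp_add] at hz1
      have hz2 := Real.exp_injective hz1
      have i1 := integrable_pK hu hz
      have i2 := integrable_pK hu' hz
      have i3 := integrable_pK hvi hz
      have i4 := integrable_pK hvi' hz
      have e : ∫ t, pK z t * v t ∂mC - ∫ t, pK z t * v' t ∂mC =
          ∫ t, pK z t * u t ∂mC - ∫ t, pK z t * u' t ∂mC := by
        rw [← integral_sub i3 i4, ← integral_sub i1 i2]
        congr 1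
        ext t
        rw [← mul_sub, ← mul_sub]
        congr 1
        simp only [hv, hv']
        have a1 := max_zero_sub_eq_self (u t)
        have a2 := max_zero_sub_eq_self (u' t)
        linarith
      linarith
  have s1 : μ' = (μ' + mC.withDensity (fun t => ENNReal.ofReal (v t))).singularPart mC :=
    Measure.eq_singularPart hvm.ennreal_ofReal (mutSing_mC hμ') rfl
  have s2 : μ = (μ + mC.withDensity (fun t => ENNReal.ofReal (v' t))).singularPart mC :=
    Measure.eq_singularPart hvm'.ennreal_ofReal (mutSing_mC hμ) rfl
  rw [s1, s2, key]

/-- A singular inner function times an outer function determines both. -/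
lemma sf_unique {S S' F F' : ℂ → ℂ} (hS : IsSingularInner S) (hS' : IsSingularInner S')
    (hF : IsOuter F) (hF' : IsOuter F')
    (h : ∀ z ∈ unitDisk, S z * F z = S' z * F' z) :
    Set.EqOn S S' unitDisk ∧ Set.EqOn F F' unitDisk := by
  obtain ⟨μ, hμ, hμs, hμi, hSμ⟩ := hS
  obtain ⟨μ', hμ', hμs', hμi', hSμ'⟩ := hS'
  obtain ⟨ω, hω, hu, hFu⟩ := isOuter_iff.1 hF
  obtain ⟨ω', hω', hu', hFu'⟩ := isOuter_iff.1 hF'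
  have hSμ1 : ∀ z ∈ unitDisk, S z = singFn μ z := hSμ
  have hSμ1' : ∀ z ∈ unitDisk, S' z = singFn μ' z := hSμ'
  have hmm : μ = μ' := by
    refine sf_measure_unique hμs hμs' hμi hμi' (hu.congr hu.1.ae_eq_mk) (hu'.congr hu'.1.ae_eq_mk)
      hu.1.stronglyMeasurable_mk.measurable hu'.1.stronglyMeasurable_mk.measurable ?_
    intro z hz
    have := congrArg norm (h z hz)
    rw [hSμ1 z hz, hSμ1' z hz, hFu z hz, hFu' z hz, outerFn_congr hu.1.ae_eq_mk,
      outerFn_congr hu'.1.ae_eq_mk] at this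
    simpa only [norm_mul, hω, hω', one_mul] using this
  have hSS : Set.EqOn S S' unitDisk := fun z hz => by
    rw [hSμ1 z hz, hSμ1' z hz, hmm]
  refine ⟨hSS, fun z hz => ?_⟩
  have h1 := h z hz
  rw [← hSS hz] at h1
  refine mul_left_cancel₀ ?_ h1
  rw [hSμ z hz]
  exact Complex.exp_ne_zero _

lemma sing_ne {S : ℂ → ℂ} (hS : IsSingularInner S) {z : ℂ} (hz : z ∈ unitDisk) : S z ≠ 0 := by
  obtain ⟨μ, -, -, -, h⟩ := hS
  rw [h z hz]
  exact Complex.exp_ne_zero _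

lemma outer_ne {F : ℂ → ℂ} (hF : IsOuter F) {z : ℂ} (hz : z ∈ unitDisk) : F z ≠ 0 := by
  obtain ⟨ω, hω, -, h⟩ := hF
  rw [h z hz]
  refine mul_ne_zero ?_ (Complex.exp_ne_zero _)
  intro h0
  simp [h0] at hω

lemma sing_diff {S : ℂ → ℂ} (hS : IsSingularInner S) : DifferentiableOn ℂ S unitDisk := by
  obtain ⟨μ, _, -, -, h⟩ := hS
  exact (differentiableOn_singFn μ).congr h

lemma outer_diff {F : ℂ → ℂ} (hF : IsOuter F) : DifferentiableOn ℂ F unitDisk := by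
  obtain ⟨ω, -, hu, h⟩ := isOuter_iff.1 hF
  exact ((differentiableOn_outerFn hu).const_mul ω).congr h

lemma order_eq {f B S F : ℂ → ℂ} (hB : IsBlaschkeProduct B) (hS : IsSingularInner S)
    (hF : IsOuter F) (h : ∀ z ∈ unitDisk, f z = B z * S z * F z) {w : ℂ} (hw : w ∈ unitDisk) :
    analyticOrderAt f w = analyticOrderAt B w := by
  have hn := isOpen_unitDisk.mem_nhds hw
  have aB := (blaschke_diff hB).analyticAt hn
  have aS := (sing_diff hS).analyticAt hn
  have aF := (outer_diff hF).analyticAt hn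
  have he : f =ᶠ[𝓝 w] B * S * F := by
    filter_upwards [hn] with z hz
    exact h z hz
  rw [analyticOrderAt_congr he, analyticOrderAt_mul (aB.mul aS) aF, analyticOrderAt_mul aB aS,
    aS.analyticOrderAt_eq_zero.2 (sing_ne hS hw), aF.analyticOrderAt_eq_zero.2 (outer_ne hF hw)]
  simp

lemma fact_unique {f B S F B' S' F' : ℂ → ℂ} (hne : ¬ Set.EqOn f 0 unitDisk)
    (hB : IsBlaschkeProduct B) (hS : IsSingularInner S)
    (hF : IsOuter F) (h : ∀ z ∈ unitDisk, f z = B z * S z * F z)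
    (hB' : IsBlaschkeProduct B') (hS' : IsSingularInner S')
    (hF' : IsOuter F') (h' : ∀ z ∈ unitDisk, f z = B' z * S' z * F' z) :
    Set.EqOn B B' unitDisk ∧ Set.EqOn S S' unitDisk ∧ Set.EqOn F F' unitDisk := by
  have hBB : Set.EqOn B B' unitDisk := blaschke_unique hB hB' fun w hw => by
    rw [← order_eq hB hS hF h hw, ← order_eq hB' hS' hF' h' hw]
  refine ⟨hBB, sf_unique hS hS' hF hF' ?_⟩
  have aB := (blaschke_diff hB).analyticOnNhd isOpen_unitDisk
  have aD := (((sing_diff hS).mul (outer_diff hF)).sub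
    ((sing_diff hS').mul (outer_diff hF'))).analyticOnNhd isOpen_unitDisk
  have hz0 : ∀ z ∈ unitDisk, B z • (S * F - S' * F') z = 0 := by
    intro z hz
    have e := (h z hz).symm.trans (h' z hz)
    rw [← hBB hz] at e
    simp only [Pi.sub_apply, Pi.mul_apply, smul_eq_mul]
    linear_combination e
  rcases aB.eq_zero_or_eq_zero_of_smul_eq_zero aD hz0
    (convex_ball (0:ℂ) 1).isPreconnected with h1 | h1
  · exact absurd (fun z hz => by rw [h z hz, h1 z hz]; simp) hne
  · intro z hz
    exact sub_eq_zero.1 (h1 z hz)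

/-- Privalov factorization. For `p > 1`, every `f ∈ N^p` which is not
identically zero factors uniquely as `f = B·S·F` on the disk, where `B` is the Blaschke product
over the zeros of `f`, `S` is a singular inner function, and `F` is an outer function with
`log⁺|F*| ∈ L^p(𝕋)`; conversely each such product `B·S·F` belongs to `N^p`. -/
theorem privalov_factorization (p : ℝ) (hp : 1 < p) :
    (∀ f ∈ NpClass p, ¬ Set.EqOn f 0 unitDisk →
      ∃ B S F : ℂ → ℂ, IsBlaschkeProduct B ∧
        {z ∈ unitDisk | B z = 0} = {z ∈ unitDisk | f z = 0} ∧
        IsSingularInner S ∧ IsOuter F ∧ LogPlusBoundaryLp p F ∧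
        (∀ z ∈ unitDisk, f z = B z * S z * F z) ∧
        (∀ B' S' F' : ℂ → ℂ, IsBlaschkeProduct B' →
          {z ∈ unitDisk | B' z = 0} = {z ∈ unitDisk | f z = 0} →
          IsSingularInner S' → IsOuter F' → LogPlusBoundaryLp p F' →
          (∀ z ∈ unitDisk, f z = B' z * S' z * F' z) →
          Set.EqOn B B' unitDisk ∧ Set.EqOn S S' unitDisk ∧ Set.EqOn F F' unitDisk)) ∧
    (∀ B S F : ℂ → ℂ, IsBlaschkeProduct B → IsSingularInner S → IsOuter F →
      LogPlusBoundaryLp p F → (fun z => B z * S z * F z) ∈ NpClass p) := by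
  refine ⟨fun f hf hne => ?_, fun B S F hB hS hF hFp =>
    converse_aux hp (blaschke_diff hB) (blaschke_norm_le hB) hS hF hFp⟩
  obtain ⟨B, S, F, hB, hS, hF, hFp, h⟩ := exists_fact hp hf hne
  refine ⟨B, S, F, hB, ?_, hS, hF, hFp, h, fun B' S' F' hB' _ hS' hF' _ h' =>
    fact_unique hne hB hS hF h hB' hS' hF' h'⟩
  ext z
  refine and_congr_right fun hz => ?_
  rw [h z hz]
  simp [sing_ne hS hz, outer_ne hF hz]
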